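/- Let θ₀ ∈ L²(0,1), T > 0, τ ∈ (0,T), and s ∈ (1,2). Let θ⁻(t,x) := ∫_{−1}^{1} E(t,x−y) θ₀^odd(y) dy with E(t,x) := e^{i x²/(4t)}/√(4πit), let φ_s be the Gevrey step function of order s, and set Y(t) := φ_s((t−τ)/(T−τ)) · ∂_x θ⁻(t,0). Define θ(t,x) := θ⁻(t,x) for 0 ≤ t ≤ τ and θ(t,x) := Σ_{j≥0} (−i)^j x^{2j+1}/(2j+1)! · Y^{(j)}(t) for τ < t ≤ T, with θ(0,·) := θ₀ on (0,1). Then: the map t ↦ θ(t,·) belongs to C([0,T]; L²(0,1)); θ is of class C^∞ on (0,T] × [0,1] and satisfies i·∂_t θ + ∂_x² θ = 0 there, with θ(t,0) = 0 for all t ∈ (0,T]; θ is Gevrey of order (s, s/2) on [ε,T] × [0,1] for every ε ∈ (0,T); and θ(T,x) = 0 for all x ∈ [0,1]. -/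

import Mathlib

open MeasureTheory Complex Real Set Filter

/-- The fundamental solution `E(t,x) = e^{i x²/(4t)} / √(4π i t)` of the 1D Schrödinger
equation, the complex square root being the principal branch. -/
noncomputable def E (t x : ℝ) : ℂ :=
  Complex.exp (Complex.I * (x : ℂ) ^ 2 / (4 * (t : ℂ))) /
    ((4 * (Real.pi : ℂ) * Complex.I * (t : ℂ)) ^ ((1 : ℂ) / 2))

/-- The odd extension of `θ₀ : (0,1) → ℂ` to `ℝ`. -/
noncomputable def thetaOdd (θ₀ : ℝ → ℂ) (x : ℝ) : ℂ :=
  if 0 < x ∧ x < 1 then θ₀ x else if -1 < x ∧ x < 0 then -θ₀ (-x) else 0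

/-- `θ⁻(t,x) = ∫_{-1}^1 E(t, x-y) θ₀^odd(y) dy`. -/
noncomputable def thetaMinus (θ₀ : ℝ → ℂ) (t x : ℝ) : ℂ :=
  ∫ y in Set.Ioo (-1 : ℝ) 1, E t (x - y) * thetaOdd θ₀ y

/-- The Gevrey step function of order `s > 1` with parameter `M > 0`,
where `σ = 1/(s-1)`. -/
noncomputable def phiStep (s M : ℝ) (ρ : ℝ) : ℝ :=
  if ρ ≤ 0 then 1
  else if 1 ≤ ρ then 0
  else Real.exp (-M / (1 - ρ) ^ ((s - 1)⁻¹)) /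
    (Real.exp (-M / ρ ^ ((s - 1)⁻¹)) + Real.exp (-M / (1 - ρ) ^ ((s - 1)⁻¹)))

/-- The flat output `Y(t) = φ_s((t-τ)/(T-τ)) ⬝ ∂_x θ⁻(t,0)`. -/
noncomputable def flatY (θ₀ : ℝ → ℂ) (s M T τ : ℝ) (t : ℝ) : ℂ :=
  (phiStep s M ((t - τ) / (T - τ)) : ℂ) * deriv (fun x => thetaMinus θ₀ t x) 0

/-- The controlled trajectory: `θ₀` at `t=0`, the dispersive solution `θ⁻` on `(0,τ]`,
and the flatness-based series on `(τ,T]` (and beyond). -/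
noncomputable def trajTheta (θ₀ : ℝ → ℂ) (s M T τ : ℝ) (t x : ℝ) : ℂ :=
  if t = 0 then θ₀ x
  else if t ≤ τ then thetaMinus θ₀ t x
  else ∑' j : ℕ, (-Complex.I) ^ j * (x : ℂ) ^ (2 * j + 1) / ((2 * j + 1).factorial : ℂ) *
    iteratedDeriv j (flatY θ₀ s M T τ) t

section Helpers

open scoped Topology ContDiff FourierTransform

theorem ContDiffAt.differentiableAt_iteratedDeriv_of_lt {𝕜 : Type*} [NontriviallyNormedField 𝕜]
    {𝕜' : Type*} [NormedAddCommGroup 𝕜'] [NormedSpace 𝕜 𝕜'] {f : 𝕜 → 𝕜'} {x : 𝕜}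
    {n : WithTop ℕ∞} {m : ℕ}
    (h : ContDiffAt 𝕜 n f x) (hmn : m < n) : DifferentiableAt 𝕜 (iteratedDeriv m f) x := by
  rw [← differentiableWithinAt_univ, ← iteratedDerivWithin_univ]
  exact h.contDiffWithinAt.differentiableWithinAt_iteratedDerivWithin hmn
    (by simp)

/-- `f` is smooth near `x`, with Gevrey bounds of order `s` uniform on a neighbourhood of `x`. -/
def GevreyAt (s : ℝ) (f : ℝ → ℂ) (x : ℝ) : Prop :=
  ∃ C K : ℝ, 0 < C ∧ 1 ≤ K ∧ ∀ᶠ y in 𝓝 x, ∀ n : ℕ,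
    DifferentiableAt ℝ (iteratedDeriv n f) y ∧
      ‖iteratedDeriv n f y‖ ≤ C * (n.factorial : ℝ) ^ s * K ^ n

theorem GevreyAt.congr {s : ℝ} {f g : ℝ → ℂ} {x : ℝ} (hf : GevreyAt s f x)
    (h : f =ᶠ[𝓝 x] g) : GevreyAt s g x := by
  obtain ⟨C, K, hC, hK, hb⟩ := hf
  refine ⟨C, K, hC, hK, ?_⟩
  filter_upwards [hb, h.eventually_nhds] with y hy hfg n
  have h1 : iteratedDeriv n f =ᶠ[𝓝 y] iteratedDeriv n g := by
    filter_upwards [hfg.eventually_nhds] with z hz using Filter.EventuallyEq.iteratedDeriv_eq n hz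
  exact ⟨(hy n).1.congr_of_eventuallyEq h1.symm, h1.eq_of_nhds ▸ (hy n).2⟩

theorem GevreyAt.eventually_contDiffAt {s : ℝ} {f : ℝ → ℂ} {x : ℝ} (hf : GevreyAt s f x) :
    ∀ᶠ y in 𝓝 x, ContDiffAt ℝ ∞ f y := by
  obtain ⟨C, K, hC, hK, hb⟩ := hf
  obtain ⟨U, hU, hUo, hxU⟩ := eventually_nhds_iff.1 hb
  have h1 : ContDiffOn ℝ ∞ f U := by
    apply contDiffOn_of_differentiableOn_deriv
    intro m _
    have h2 : DifferentiableOn ℝ (iteratedDeriv m f) U := fun y hy =>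
      ((hU y hy m).1).differentiableWithinAt
    exact h2.congr fun y hy => iteratedDerivWithin_of_isOpen hUo hy
  filter_upwards [hUo.mem_nhds hxU] with y hy using h1.contDiffAt (hUo.mem_nhds hy)

theorem gevreyAt_of_eventually {s : ℝ} {f : ℝ → ℂ} {x C K : ℝ}
    (hb : ∀ᶠ y in 𝓝 x, ∀ n : ℕ, ‖iteratedDeriv n f y‖ ≤ C * (n.factorial : ℝ) ^ s * K ^ n)
    (hd : ∀ᶠ y in 𝓝 x, ContDiffAt ℝ ∞ f y) : GevreyAt s f x := by
  refine ⟨|C| + 1, |K| + 1, by positivity, by linarith [abs_nonneg K], ?_⟩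
  filter_upwards [hb, hd] with y hy hdy n
  refine ⟨ContDiffAt.differentiableAt_iteratedDeriv_of_lt hdy
    (by exact_mod_cast ENat.natCast_lt_top n),
    (hy n).trans ?_⟩
  have h1 : K ^ n ≤ (|K| + 1) ^ n := by
    calc K ^ n ≤ |K ^ n| := le_abs_self _
      _ = |K| ^ n := abs_pow _ _
      _ ≤ _ := by gcongr; linarith
  calc C * (n.factorial : ℝ) ^ s * K ^ n ≤ |C * (n.factorial : ℝ) ^ s * K ^ n| := le_abs_self _
    _ = |C| * (n.factorial : ℝ) ^ s * |K| ^ n := by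
      rw [abs_mul, abs_mul, abs_pow, abs_of_nonneg (a := (n.factorial : ℝ) ^ s) (by positivity)]
    _ ≤ _ := by gcongr <;> linarith

theorem gevreyAt_const (s : ℝ) (c : ℂ) (x : ℝ) (hs : 0 ≤ s) : GevreyAt s (fun _ => c) x := by
  refine gevreyAt_of_eventually (C := ‖c‖) (K := 1) (.of_forall fun y n => ?_)
    (.of_forall fun y => contDiffAt_const)
  rw [iteratedDeriv_const]
  have : (1 : ℝ) ≤ (n.factorial : ℝ) ^ s :=
    Real.one_le_rpow (by exact_mod_cast n.factorial_pos) hs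
  split_ifs
  · simpa using le_mul_of_one_le_right (norm_nonneg c) this
  · simp; positivity

theorem GevreyAt.sub {s : ℝ} {f g : ℝ → ℂ} {x : ℝ} (hf : GevreyAt s f x) (hg : GevreyAt s g x) :
    GevreyAt s (fun t => f t - g t) x := by
  have hfd := hf.eventually_contDiffAt
  have hgd := hg.eventually_contDiffAt
  obtain ⟨C, K, hC, hK, hb⟩ := hf
  obtain ⟨C', K', hC', hK', hb'⟩ := hg
  refine gevreyAt_of_eventually (C := C + C') (K := K + K') ?_ ?_
  · filter_upwards [hb, hb', hfd, hgd] with y h1 h2 h3 h4 n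
    rw [iteratedDeriv_fun_sub (h3.of_le (mod_cast le_top)) (h4.of_le (mod_cast le_top))]
    refine (norm_sub_le _ _).trans ((add_le_add (h1 n).2 (h2 n).2).trans ?_)
    have : C * (n.factorial : ℝ) ^ s * K ^ n ≤ C * (n.factorial : ℝ) ^ s * (K + K') ^ n := by
      gcongr; linarith
    have : C' * (n.factorial : ℝ) ^ s * K' ^ n ≤ C' * (n.factorial : ℝ) ^ s * (K + K') ^ n := by
      gcongr; linarith
    linarith
  · filter_upwards [hfd, hgd] with y h3 h4 using h3.sub h4

theorem choose_mul_factorial_rpow_le {s : ℝ} (hs : 1 ≤ s) {n i : ℕ} (hi : i ≤ n) :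
    (n.choose i : ℝ) * ((i.factorial : ℝ) ^ s * ((n - i).factorial : ℝ) ^ s)
      ≤ (n.factorial : ℝ) ^ s := by
  have h1 : (1 : ℝ) ≤ n.choose i := by exact_mod_cast Nat.choose_pos hi
  have h2 : (n.choose i : ℝ) * i.factorial * (n - i).factorial = n.factorial := by
    exact_mod_cast Nat.choose_mul_factorial_mul_factorial hi
  calc (n.choose i : ℝ) * ((i.factorial : ℝ) ^ s * ((n - i).factorial : ℝ) ^ s)
      ≤ (n.choose i : ℝ) ^ s * ((i.factorial : ℝ) ^ s * ((n - i).factorial : ℝ) ^ s) := by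
        gcongr
        exact Real.self_le_rpow_of_one_le h1 hs
    _ = (n.factorial : ℝ) ^ s := by
      rw [← h2, Real.mul_rpow (by positivity) (by positivity),
        Real.mul_rpow (by positivity) (by positivity), mul_assoc]

theorem GevreyAt.mul {s : ℝ} (hs : 1 ≤ s) {f g : ℝ → ℂ} {x : ℝ} (hf : GevreyAt s f x)
    (hg : GevreyAt s g x) : GevreyAt s (fun t => f t * g t) x := by
  have hfd := hf.eventually_contDiffAt
  have hgd := hg.eventually_contDiffAt
  obtain ⟨C, K, hC, hK, hb⟩ := hf
  obtain ⟨C', K', hC', hK', hb'⟩ := hg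
  refine gevreyAt_of_eventually (C := C * C') (K := 2 * (K * K')) ?_ ?_
  · filter_upwards [hb, hb', hfd, hgd] with y h1 h2 h3 h4 n
    rw [iteratedDeriv_fun_mul (h3.of_le (mod_cast le_top)) (h4.of_le (mod_cast le_top))]
    have hterm : ∀ i ∈ Finset.range (n + 1),
        ‖(n.choose i : ℂ) * iteratedDeriv i f y * iteratedDeriv (n - i) g y‖
          ≤ C * C' * (n.factorial : ℝ) ^ s * (K * K') ^ n := by
      intro i hi
      have hin : i ≤ n := Nat.lt_succ_iff.1 (Finset.mem_range.1 hi)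
      have hKi : K ^ i ≤ K ^ n := pow_le_pow_right₀ hK hin
      have hKi' : K' ^ (n - i) ≤ K' ^ n := pow_le_pow_right₀ hK' (Nat.sub_le _ _)
      rw [norm_mul, norm_mul, Complex.norm_natCast]
      calc (n.choose i : ℝ) * ‖iteratedDeriv i f y‖ * ‖iteratedDeriv (n - i) g y‖
          ≤ (n.choose i : ℝ) * (C * (i.factorial : ℝ) ^ s * K ^ i) *
            (C' * ((n - i).factorial : ℝ) ^ s * K' ^ (n - i)) := by
            gcongr
            · exact (h1 i).2
            · exact (h2 _).2
        _ ≤ (n.choose i : ℝ) * (C * (i.factorial : ℝ) ^ s * K ^ n) *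
            (C' * ((n - i).factorial : ℝ) ^ s * K' ^ n) := by gcongr
        _ = C * C' * ((n.choose i : ℝ) * ((i.factorial : ℝ) ^ s * ((n - i).factorial : ℝ) ^ s))
            * (K * K') ^ n := by rw [mul_pow]; ring
        _ ≤ _ := by gcongr; exact choose_mul_factorial_rpow_le hs hin
    refine (norm_sum_le_of_le _ hterm).trans ?_
    rw [Finset.sum_const, Finset.card_range, nsmul_eq_mul, mul_pow 2 (K * K')]
    have h5 : ((n + 1 : ℕ) : ℝ) ≤ 2 ^ n := by exact_mod_cast Nat.lt_two_pow_self
    calc ((n + 1 : ℕ) : ℝ) * (C * C' * (n.factorial : ℝ) ^ s * (K * K') ^ n)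
        ≤ 2 ^ n * (C * C' * (n.factorial : ℝ) ^ s * (K * K') ^ n) := by gcongr
      _ = _ := by ring
  · filter_upwards [hfd, hgd] with y h3 h4 using h3.mul h4

theorem iteratedDeriv_comp_affine (f : ℝ → ℂ) (a b : ℝ) (n : ℕ) :
    iteratedDeriv n (fun t => f (a * t + b)) = fun t => a ^ n • iteratedDeriv n f (a * t + b) := by
  induction n with
  | zero => simp
  | succ n ih =>
    ext t
    rw [iteratedDeriv_succ, ih, deriv_fun_const_smul_field,
      deriv_comp_mul_left a (fun u => iteratedDeriv n f (u + b)), deriv_comp_add_const,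
      iteratedDeriv_succ, smul_smul, pow_succ]

theorem GevreyAt.comp_affine {s : ℝ} {f : ℝ → ℂ} {a b x : ℝ} (hf : GevreyAt s f (a * x + b)) :
    GevreyAt s (fun t => f (a * t + b)) x := by
  have hc : Tendsto (fun t : ℝ => a * t + b) (𝓝 x) (𝓝 (a * x + b)) :=
    (by fun_prop : Continuous fun t : ℝ => a * t + b).tendsto x
  have hfd := hf.eventually_contDiffAt
  obtain ⟨C, K, hC, hK, hb⟩ := hf
  refine gevreyAt_of_eventually (C := C) (K := |a| * K) ?_ ?_
  · filter_upwards [hc.eventually hb] with y hy n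
    rw [iteratedDeriv_comp_affine, norm_smul, norm_pow, Real.norm_eq_abs, mul_pow]
    calc |a| ^ n * ‖iteratedDeriv n f (a * y + b)‖
        ≤ |a| ^ n * (C * (n.factorial : ℝ) ^ s * K ^ n) := by gcongr; exact (hy n).2
      _ = _ := by ring
  · filter_upwards [hc.eventually hfd] with y hy
    exact hy.comp (f := fun t : ℝ => a * t + b) y (by fun_prop)

theorem iteratedDeriv_eq_of_analyticAt {f : ℝ → ℂ} {F : ℂ → ℂ} {U : Set ℝ} (hU : IsOpen U)
    (hF : ∀ y ∈ U, AnalyticAt ℂ F y) (hfF : ∀ y ∈ U, f y = F y) (n : ℕ) :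
    ∀ y ∈ U, iteratedDeriv n f y = iteratedDeriv n F y ∧
      DifferentiableAt ℝ (iteratedDeriv n f) y := by
  have key : ∀ n, (∀ y ∈ U, iteratedDeriv n f y = iteratedDeriv n F y) → ∀ y ∈ U,
      HasDerivAt (iteratedDeriv n f) (iteratedDeriv (n + 1) F y) y := by
    intro n hn y hy
    have h1 : HasDerivAt (iteratedDeriv n F) (iteratedDeriv (n + 1) F y) (y : ℂ) := by
      rw [iteratedDeriv_succ]
      exact (ContDiffAt.differentiableAt_iteratedDeriv_of_lt ((hF y hy).contDiffAt (n := ∞))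
        (by exact_mod_cast ENat.natCast_lt_top n)).hasDerivAt
    refine h1.comp_ofReal.congr_of_eventuallyEq ?_
    filter_upwards [hU.mem_nhds hy] with z hz using hn z hz
  have heq : ∀ n, ∀ y ∈ U, iteratedDeriv n f y = iteratedDeriv n F y := by
    intro n
    induction n with
    | zero => simpa using hfF
    | succ n ih =>
      intro y hy
      rw [iteratedDeriv_succ, (key n ih y hy).deriv]
  exact fun y hy => ⟨heq n y hy, (key n (heq n) y hy).differentiableAt⟩

theorem gevreyAt_of_analyticAt {s : ℝ} (hs : 1 ≤ s) {f : ℝ → ℂ} {F : ℂ → ℂ} {x : ℝ}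
    (hF : AnalyticAt ℂ F x) (hfF : ∀ᶠ y in 𝓝 x, f y = F y) : GevreyAt s f x := by
  obtain ⟨r, hr, hball⟩ := Metric.eventually_nhds_iff_ball.1
    (hF.eventually_analyticAt.and (hF.continuousAt.eventually
      (Metric.ball_mem_nhds (F x) one_pos)))
  obtain ⟨r', hr', hball'⟩ := Metric.eventually_nhds_iff_ball.1 hfF
  have hsub : ∀ y ∈ Metric.ball x (min (r / 2) r'), (y : ℂ) ∈ Metric.ball (x : ℂ) r := by
    intro y hy
    rw [Metric.mem_ball, lt_min_iff] at hy
    rw [Metric.mem_ball, Complex.dist_eq, ← Complex.ofReal_sub, Complex.norm_real,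
      ← dist_eq_norm]
    linarith
  have key := fun n => iteratedDeriv_eq_of_analyticAt (f := f) (F := F)
    (U := Metric.ball x (min (r / 2) r')) Metric.isOpen_ball
    (fun y hy => (hball y (hsub y hy)).1)
    (fun y hy => hball' y (Metric.ball_subset_ball (min_le_right _ _) hy)) n
  refine ⟨‖F x‖ + 1, max 1 (4 / r), by positivity, le_max_left _ _, ?_⟩
  filter_upwards [Metric.ball_mem_nhds x (lt_min (half_pos hr) hr')] with y hy n
  refine ⟨(key n y hy).2, ?_⟩
  rw [(key n y hy).1]
  have hyx : dist (y : ℂ) x < r / 2 := by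
    rw [Complex.dist_eq, ← Complex.ofReal_sub, Complex.norm_real, ← dist_eq_norm]
    exact (Metric.mem_ball.1 hy).trans_le (min_le_left _ _)
  have hcb : ∀ z ∈ Metric.closedBall (y : ℂ) (r / 4), z ∈ Metric.ball (x : ℂ) r := by
    intro z hz
    rw [Metric.mem_closedBall] at hz
    rw [Metric.mem_ball]
    linarith [dist_triangle z (y : ℂ) x]
  have hdiff : DiffContOnCl ℂ F (Metric.ball (y : ℂ) (r / 4)) := by
    refine DifferentiableOn.diffContOnCl fun z hz => ?_
    rw [closure_ball _ (by positivity)] at hz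
    exact (hball z (hcb z hz)).1.differentiableAt.differentiableWithinAt
  have hbound : ∀ z ∈ Metric.sphere (y : ℂ) (r / 4), ‖F z‖ ≤ ‖F x‖ + 1 := by
    intro z hz
    have h1 := (hball z (hcb z (Metric.sphere_subset_closedBall hz))).2
    rw [dist_eq_norm] at h1
    linarith [norm_sub_norm_le (F z) (F x)]
  refine (Complex.norm_iteratedDeriv_le_of_forall_mem_sphere_norm_le n (by positivity) hdiff
    hbound).trans ?_
  have h1 : (1 : ℝ) ≤ n.factorial := by exact_mod_cast n.factorial_pos
  calc n.factorial * (‖F x‖ + 1) / (r / 4) ^ n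
      = (‖F x‖ + 1) * n.factorial * (4 / r) ^ n := by
        rw [div_eq_mul_inv, ← inv_pow, inv_div]; ring
    _ ≤ _ := by
      gcongr
      · exact Real.self_le_rpow_of_one_le h1 hs
      · exact le_max_right _ _

theorem exp_neg_rpow_le {m σ ρ : ℝ} (hm : 0 < m) (hσ : 0 < σ) (hρ : 0 < ρ) (k : ℕ) :
    Real.exp (-(m * ρ ^ (-σ))) ≤
      ρ ^ k * (k.factorial : ℝ) ^ σ⁻¹ * ((m * σ) ^ (-σ⁻¹)) ^ k := by
  have hu : 0 < ρ ^ (-σ) := Real.rpow_pos_of_pos hρ _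
  have h1 : (m * σ * ρ ^ (-σ)) ^ k / k.factorial ≤ Real.exp (m * σ * ρ ^ (-σ)) :=
    Real.pow_div_factorial_le_exp _ (by positivity) k
  have h2 := Real.rpow_le_rpow (by positivity) h1 (inv_nonneg.2 hσ.le)
  rw [Real.div_rpow (by positivity) (by positivity), ← Real.exp_mul] at h2
  have h3 : m * σ * ρ ^ (-σ) * σ⁻¹ = m * ρ ^ (-σ) := by field_simp
  have h4 : ((m * σ * ρ ^ (-σ)) ^ k) ^ σ⁻¹ = ((m * σ) ^ σ⁻¹) ^ k * (ρ ^ k)⁻¹ := by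
    rw [← Real.rpow_natCast, ← Real.rpow_mul (by positivity), mul_comm (k : ℝ),
      Real.rpow_mul (by positivity), Real.mul_rpow (by positivity) (by positivity),
      ← Real.rpow_mul hρ.le, Real.rpow_natCast, mul_pow]
    have : -σ * σ⁻¹ = -1 := by field_simp
    rw [this, Real.rpow_neg_one, inv_pow]
  rw [h3, h4] at h2
  have hA : 0 < (m * σ) ^ σ⁻¹ := Real.rpow_pos_of_pos (by positivity) _
  have hf : 0 < (k.factorial : ℝ) ^ σ⁻¹ := Real.rpow_pos_of_pos (by positivity) _
  rw [Real.exp_neg, Real.rpow_neg (x := m * σ) (by positivity)]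
  refine (inv_anti₀ (by positivity) h2).trans (le_of_eq ?_)
  rw [inv_pow]
  field_simp

theorem gevreyAt_zero_of_flat {g : ℝ → ℂ} {B m σ c δ : ℝ} (hσ : 0 < σ) (hm : 0 < m)
    (hc : 0 < c) (hδ : 0 < δ) (hg : ∀ ρ ≤ 0, g ρ = 0)
    (hH : ∀ ρ ∈ Ioo 0 δ, ∃ H : ℂ → ℂ, DifferentiableOn ℂ H (Metric.ball 0 (2 * c)) ∧
      (∀ w : ℝ, |w| < 2 * c → g (ρ * w + ρ) = H w) ∧
      ∀ w ∈ Metric.ball (0 : ℂ) (2 * c), ‖H w‖ ≤ B * Real.exp (-(m * ρ ^ (-σ)))) :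
    GevreyAt (1 + σ⁻¹) g 0 := by
  have hB : 0 ≤ B := by
    obtain ⟨H, -, -, h⟩ := hH (δ / 2) ⟨by positivity, by linarith⟩
    have h0 := (norm_nonneg _).trans (h 0 (Metric.mem_ball_self (by positivity)))
    exact nonneg_of_mul_nonneg_left h0 (Real.exp_pos _)
  set L : ℝ := (m * σ) ^ (-σ⁻¹) with hL
  have hLpos : 0 < L := Real.rpow_pos_of_pos (by positivity) _
  have hpos : ∀ ρ ∈ Ioo 0 δ, ∀ n : ℕ, DifferentiableAt ℝ (iteratedDeriv n g) ρ ∧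
      ρ ^ n * ‖iteratedDeriv n g ρ‖ ≤ n.factorial * (B * Real.exp (-(m * ρ ^ (-σ)))) / c ^ n := by
    intro ρ hρ n
    have hρ0 : ρ ≠ 0 := hρ.1.ne'
    obtain ⟨H, hd, hgH, hb⟩ := hH ρ hρ
    have hsub : ∀ w ∈ Ioo (-(2 * c)) (2 * c), ((w : ℝ) : ℂ) ∈ Metric.ball (0 : ℂ) (2 * c) := by
      intro w hw
      simpa [abs_lt] using hw
    have key := iteratedDeriv_eq_of_analyticAt (f := fun w : ℝ => g (ρ * w + ρ)) (F := H)
      (U := Ioo (-(2 * c)) (2 * c)) isOpen_Ioo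
      (fun w hw => hd.analyticAt (Metric.isOpen_ball.mem_nhds (hsub w hw)))
      (fun w hw => hgH w (abs_lt.2 hw)) n 0 ⟨by linarith, by linarith⟩
    rw [iteratedDeriv_comp_affine] at key
    obtain ⟨h1, h2⟩ := key
    simp only [mul_zero, zero_add, Complex.ofReal_zero] at h1
    constructor
    · have h3 : DifferentiableAt ℝ (fun w : ℝ => ρ ^ n • iteratedDeriv n g (ρ * w + ρ))
          ((ρ - ρ) / ρ) := by simpa using h2
      have h4 : DifferentiableAt ℝ (fun t : ℝ => (t - ρ) / ρ) ρ := by fun_prop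
      have h5 := (h3.comp (f := fun t : ℝ => (t - ρ) / ρ) ρ h4).const_smul ((ρ⁻¹) ^ n)
      refine h5.congr_of_eventuallyEq (.of_forall fun t => ?_)
      have : ρ * ((t - ρ) / ρ) + ρ = t := by field_simp; ring
      simp only [Pi.smul_apply, Function.comp_apply, this, smul_smul, ← mul_pow,
        inv_mul_cancel₀ hρ0, one_pow, one_smul]
    · have h3 := Complex.norm_iteratedDeriv_le_of_forall_mem_sphere_norm_le n hc
        (f := H) (c := 0) (C := B * Real.exp (-(m * ρ ^ (-σ)))) ?_ ?_
      · rw [← h1, norm_smul, norm_pow, Real.norm_eq_abs, abs_of_pos hρ.1] at h3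
        exact h3
      · refine DifferentiableOn.diffContOnCl (hd.mono ?_)
        rw [closure_ball _ hc.ne']
        exact Metric.closedBall_subset_ball (by linarith)
      · intro z hz
        exact hb z ((Metric.sphere_subset_closedBall.trans
          (Metric.closedBall_subset_ball (by linarith))) hz)
  have hneg : ∀ ρ < 0, ∀ n : ℕ, iteratedDeriv n g =ᶠ[𝓝 ρ] fun _ => 0 := by
    intro ρ hρ n
    have h0 : g =ᶠ[𝓝 ρ] fun _ => 0 := by
      filter_upwards [Iio_mem_nhds hρ] with y hy using hg y (le_of_lt hy)
    filter_upwards [h0.eventually_nhds] with y hy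
    rw [Filter.EventuallyEq.iteratedDeriv_eq n hy, iteratedDeriv_const]
    simp
  have hsq : ∀ n : ℕ, iteratedDeriv n g 0 = 0 → HasDerivAt (iteratedDeriv n g) 0 0 := by
    intro n hn
    have hO : iteratedDeriv n g =O[𝓝 0] fun ρ => ‖ρ - 0‖ ^ 2 := by
      refine Asymptotics.IsBigO.of_bound (n.factorial * B / c ^ n *
        (((n + 2).factorial : ℝ) ^ σ⁻¹ * L ^ (n + 2))) ?_
      filter_upwards [Iio_mem_nhds hδ] with ρ hρδ
      rcases lt_trichotomy ρ 0 with h | h | h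
      · rw [(hneg ρ h n).eq_of_nhds]; simp; positivity
      · rw [h, hn]; simp
      · have h1 := (hpos ρ ⟨h, hρδ⟩ n).2
        have h2 := exp_neg_rpow_le hm hσ h (n + 2)
        simp only [sub_zero, norm_pow, Real.norm_eq_abs, abs_of_pos h]
        refine le_of_mul_le_mul_left ?_ (pow_pos h n)
        calc ρ ^ n * ‖iteratedDeriv n g ρ‖
            ≤ n.factorial * (B * Real.exp (-(m * ρ ^ (-σ)))) / c ^ n := h1
          _ ≤ n.factorial * (B * (ρ ^ (n + 2) * ((n + 2).factorial : ℝ) ^ σ⁻¹ *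
              L ^ (n + 2))) / c ^ n := by gcongr
          _ = _ := by ring
    have h3 : HasFDerivAt (iteratedDeriv n g) (0 : ℝ →L[ℝ] ℂ) 0 := hO.hasFDerivAt (by norm_num)
    simpa using h3.hasDerivAt
  have hzero : ∀ n : ℕ, iteratedDeriv n g 0 = 0 := by
    intro n
    induction n with
    | zero => simpa using hg 0 le_rfl
    | succ n ih => rw [iteratedDeriv_succ, (hsq n ih).deriv]
  refine ⟨B + 1, max 1 (L / c), by positivity, le_max_left _ _, ?_⟩
  filter_upwards [Iio_mem_nhds hδ] with ρ hρδ n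
  rcases lt_trichotomy ρ 0 with h | h | h
  · refine ⟨(differentiableAt_const (0 : ℂ)).congr_of_eventuallyEq (hneg ρ h n), ?_⟩
    rw [(hneg ρ h n).eq_of_nhds]; simp; positivity
  · rw [h, hzero n]
    exact ⟨(hsq n (hzero n)).differentiableAt, by simp; positivity⟩
  · refine ⟨(hpos ρ ⟨h, hρδ⟩ n).1, ?_⟩
    have h1 := (hpos ρ ⟨h, hρδ⟩ n).2
    have h2 := exp_neg_rpow_le hm hσ h n
    refine le_of_mul_le_mul_left ?_ (pow_pos h n)
    have hfac : (n.factorial : ℝ) ^ (1 + σ⁻¹) = n.factorial * (n.factorial : ℝ) ^ σ⁻¹ := by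
      rw [Real.rpow_add (by positivity), Real.rpow_one]
    calc ρ ^ n * ‖iteratedDeriv n g ρ‖
        ≤ n.factorial * (B * Real.exp (-(m * ρ ^ (-σ)))) / c ^ n := h1
      _ ≤ n.factorial * (B * (ρ ^ n * (n.factorial : ℝ) ^ σ⁻¹ * L ^ n)) / c ^ n := by gcongr
      _ = ρ ^ n * (B * (n.factorial : ℝ) ^ (1 + σ⁻¹) * (L / c) ^ n) := by
        rw [hfac, div_pow]; ring
      _ ≤ _ := by
        gcongr
        · linarith
        · exact le_max_right _ _

theorem one_add_slitPlane {z : ℂ} (hz : ‖z‖ < 1) : 1 + z ∈ slitPlane :=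
  mem_slitPlane_of_norm_lt_one hz

theorem exists_norm_one_add_cpow_sub_one_lt (σ : ℝ) {ε : ℝ} (hε : 0 < ε) :
    ∃ r > 0, r ≤ 1 / 2 ∧ ∀ w : ℂ, ‖w‖ < r → ‖(1 + w) ^ (-(σ : ℂ)) - 1‖ < ε := by
  have hc : ContinuousAt (fun w : ℂ => (1 + w) ^ (-(σ : ℂ))) 0 := by
    refine ContinuousAt.cpow (by fun_prop) (by fun_prop) (by simp)
  obtain ⟨r, hr, h⟩ := Metric.continuousAt_iff.1 hc ε hε
  refine ⟨min r (1 / 2), by positivity, min_le_right _ _, fun w hw => ?_⟩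
  have := h (x := w) (by simpa using hw.trans_le (min_le_left _ _))
  simpa [dist_eq_norm] using this

theorem ofReal_rpow_neg {x : ℝ} (hx : 0 < x) (σ : ℝ) :
    ((x ^ (-σ) : ℝ) : ℂ) = (x : ℂ) ^ (-(σ : ℂ)) := by
  rw [Complex.ofReal_cpow hx.le]; simp

theorem one_sub_phiStep_eq {s M ρ : ℝ} (h0 : 0 < ρ) (h1 : ρ < 1) :
    1 - phiStep s M ρ =
      Real.exp (M * (1 - ρ) ^ (-(s - 1)⁻¹) - M * ρ ^ (-(s - 1)⁻¹)) /
        (1 + Real.exp (M * (1 - ρ) ^ (-(s - 1)⁻¹) - M * ρ ^ (-(s - 1)⁻¹))) := by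
  rw [phiStep, if_neg h0.not_ge, if_neg h1.not_ge, Real.exp_sub, Real.rpow_neg h0.le,
    Real.rpow_neg (by linarith), neg_div, neg_div, Real.exp_neg, Real.exp_neg, ← div_eq_mul_inv,
    ← div_eq_mul_inv]
  have := Real.exp_pos (M / (1 - ρ) ^ (s - 1)⁻¹)
  have := Real.exp_pos (M / ρ ^ (s - 1)⁻¹)
  field_simp
  ring

theorem gevreyAt_one_sub_phiStep_zero {s M : ℝ} (hs : 1 < s) (hM : 0 < M) :
    GevreyAt s (fun ρ => ((1 - phiStep s M ρ : ℝ) : ℂ)) 0 := by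
  set σ := (s - 1)⁻¹ with hσdef
  have hσ : 0 < σ := inv_pos.2 (by linarith)
  have hsσ : s = 1 + σ⁻¹ := by rw [hσdef, inv_inv]; ring
  obtain ⟨r, hr, hr2, hrb⟩ := exists_norm_one_add_cpow_sub_one_lt σ (ε := 1 / 2) (by norm_num)
  obtain ⟨q, hq, hq2, hqb⟩ := exists_norm_one_add_cpow_sub_one_lt σ (ε := 1) (by norm_num)
  set L : ℝ := (M / 2 * σ) ^ (-σ⁻¹) with hL
  have hLpos : 0 < L := Real.rpow_pos_of_pos (by positivity) _
  set e := Real.exp (2 * M) with he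
  have hepos : 0 < e := Real.exp_pos _
  have hδ : 0 < min (q / 2) (1 / (2 * e * L)) := by positivity
  suffices hgoal : GevreyAt (1 + σ⁻¹) (fun ρ => ((1 - phiStep s M ρ : ℝ) : ℂ)) 0 by
    rwa [← hsσ] at hgoal
  refine gevreyAt_zero_of_flat (B := 2 * e) (m := M / 2) (c := r / 2) hσ (by positivity)
    (by positivity) hδ ?_ ?_
  · intro ρ hρ
    simp [phiStep, hρ]
  intro ρ hρ
  have hρ0 : 0 < ρ := hρ.1
  have hρq : ρ < q / 2 := hρ.2.trans_le (min_le_left _ _)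
  have hρe : ρ < 1 / (2 * e * L) := hρ.2.trans_le (min_le_right _ _)
  rw [show 2 * (r / 2) = r by ring]
  set h : ℂ → ℂ := fun w => Complex.exp (M * (1 + -(ρ * (1 + w))) ^ (-(σ : ℂ)) -
    M * (ρ ^ (-σ) : ℝ) * (1 + w) ^ (-(σ : ℂ))) with hh
  have hsmall : e * Real.exp (-(M / 2 * ρ ^ (-σ))) ≤ 1 / 2 := by
    have := exp_neg_rpow_le (m := M / 2) (by positivity) hσ hρ0 1
    simp only [pow_one, Nat.factorial_one, Nat.cast_one, Real.one_rpow, mul_one] at this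
    rw [lt_div_iff₀ (by positivity)] at hρe
    nlinarith
  have hwin : ∀ w ∈ Metric.ball (0 : ℂ) r, ‖w‖ < r := by simp
  have hzq : ∀ w : ℂ, ‖w‖ < r → ‖-((ρ : ℂ) * (1 + w))‖ < q := by
    intro w hw
    rw [norm_neg, norm_mul, Complex.norm_real, Real.norm_eq_abs, abs_of_pos hρ0]
    have : ‖1 + w‖ ≤ 2 := (norm_add_le _ _).trans (by simp; linarith)
    nlinarith [norm_nonneg (1 + w)]
  have hhb : ∀ w : ℂ, ‖w‖ < r → ‖h w‖ ≤ e * Real.exp (-(M / 2 * ρ ^ (-σ))) := by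
    intro w hw
    have h1 := hrb w hw
    have h2 := hqb _ (hzq w hw)
    have h3 := (Complex.abs_re_le_norm _).trans_lt h1
    have h4 := (Complex.abs_re_le_norm _).trans_lt h2
    rw [Complex.sub_re, Complex.one_re, abs_lt] at h3 h4
    rw [hh, Complex.norm_exp, he, ← Real.exp_add]
    refine Real.exp_le_exp.2 ?_
    rw [Complex.sub_re, ← Complex.ofReal_mul, Complex.re_ofReal_mul, Complex.re_ofReal_mul]
    have h5 : M * (1 / 2) ≤ M * ((1 + w) ^ (-(σ : ℂ))).re := by gcongr; linarith
    have h6 : M * ((1 + -((ρ : ℂ) * (1 + w))) ^ (-(σ : ℂ))).re ≤ M * 2 := by gcongr; linarith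
    have h7 := mul_le_mul_of_nonneg_right h5 (Real.rpow_pos_of_pos hρ0 (-σ)).le
    nlinarith
  have hden : ∀ w : ℂ, ‖w‖ < r → 1 / 2 ≤ ‖1 + h w‖ := by
    intro w hw
    have h1 := norm_sub_norm_le (1 : ℂ) (-h w)
    rw [norm_one, norm_neg, sub_neg_eq_add] at h1
    linarith [hhb w hw]
  refine ⟨fun w => h w / (1 + h w), ?_, ?_, ?_⟩
  · intro w hw
    have hw' := hwin w hw
    have hs1 : 1 + w ∈ slitPlane := one_add_slitPlane (by linarith)
    have hs2 : 1 + -((ρ : ℂ) * (1 + w)) ∈ slitPlane :=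
      one_add_slitPlane (by linarith [hzq w hw'])
    have hd : DifferentiableAt ℂ h w := by
      rw [hh]
      refine DifferentiableAt.cexp (DifferentiableAt.sub (DifferentiableAt.const_mul ?_ _)
        (DifferentiableAt.const_mul ?_ _))
      · exact DifferentiableAt.cpow (by fun_prop) (by fun_prop) hs2
      · exact DifferentiableAt.cpow (by fun_prop) (by fun_prop) hs1
    refine (hd.div (by fun_prop) ?_).differentiableWithinAt
    rw [← norm_pos_iff]; linarith [hden w hw']
  · intro w hw
    rw [abs_lt] at hw
    have hpos1 : 0 < 1 + w := by linarith
    have hpos : 0 < ρ * w + ρ := by nlinarith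
    have hlt : ρ * w + ρ < 1 := by nlinarith
    rw [one_sub_phiStep_eq hpos hlt]
    have : (Real.exp (M * (1 - (ρ * w + ρ)) ^ (-σ) - M * (ρ * w + ρ) ^ (-σ)) : ℂ) = h w := by
      rw [hh, show ρ * w + ρ = ρ * (1 + w) by ring, Real.mul_rpow hρ0.le hpos1.le,
        Complex.ofReal_exp]
      simp only [Complex.ofReal_sub, Complex.ofReal_mul]
      rw [ofReal_rpow_neg (by nlinarith), ofReal_rpow_neg hpos1]
      push_cast
      congr 1
      ring_nf
    rw [← hσdef, Complex.ofReal_div, Complex.ofReal_add, this]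
    simp
  · intro w hw
    have hw' := hwin w hw
    rw [norm_div, div_le_iff₀ (by linarith [hden w hw'])]
    have h1 := hhb w hw'
    have h2 := hden w hw'
    nlinarith [norm_nonneg (h w), mul_nonneg hepos.le (Real.exp_pos (-(M / 2 * ρ ^ (-σ)))).le]

theorem phiStep_one_sub (s M ρ : ℝ) : phiStep s M (1 - ρ) = 1 - phiStep s M ρ := by
  rcases le_or_gt ρ 0 with h | h
  · simp [phiStep, h, (by linarith : 1 ≤ 1 - ρ), (by linarith : ¬ 1 - ρ ≤ 0)]
  rcases le_or_gt 1 ρ with h1 | h1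
  · simp [phiStep, h1, (by linarith : 1 - ρ ≤ 0), (by linarith : ¬ ρ ≤ 0)]
  · simp only [phiStep, (by linarith : ¬ 1 - ρ ≤ 0), (by linarith : ¬ ρ ≤ 0),
      (by linarith : ¬ 1 ≤ 1 - ρ), (by linarith : ¬ 1 ≤ ρ), if_false, sub_sub_cancel]
    have := Real.exp_pos (-M / (1 - ρ) ^ (s - 1)⁻¹)
    have := Real.exp_pos (-M / ρ ^ (s - 1)⁻¹)
    field_simp
    ring

theorem gevreyAt_phiStep {s M : ℝ} (hs : 1 < s) (hM : 0 < M) (ρ : ℝ) :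
    GevreyAt s (fun ρ => (phiStep s M ρ : ℂ)) ρ := by
  have h0 := gevreyAt_one_sub_phiStep_zero hs hM
  rcases lt_trichotomy ρ 0 with h | h | h
  · refine (gevreyAt_const s 1 ρ (by linarith)).congr ?_
    filter_upwards [Iio_mem_nhds h] with y hy
    simp [phiStep, (show y < 0 from hy).le]
  · rw [h]
    refine ((gevreyAt_const s 1 0 (by linarith)).sub h0).congr (.of_forall fun y => ?_)
    simp
  rcases lt_trichotomy ρ 1 with h1 | h1 | h1
  · refine gevreyAt_of_analyticAt hs.le (F := fun z => Complex.exp (-M / (1 - z) ^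
      (((s - 1)⁻¹ : ℝ) : ℂ)) / (Complex.exp (-M / z ^ (((s - 1)⁻¹ : ℝ) : ℂ)) +
      Complex.exp (-M / (1 - z) ^ (((s - 1)⁻¹ : ℝ) : ℂ)))) ?_ ?_
    · have hs1 : (ρ : ℂ) ∈ slitPlane := by simp [h]
      have hs2 : (1 - ρ : ℂ) ∈ slitPlane := by
        rw [← Complex.ofReal_one, ← Complex.ofReal_sub, Complex.ofReal_mem_slitPlane]; linarith
      have ha1 : AnalyticAt ℂ (fun z : ℂ => z ^ (((s - 1)⁻¹ : ℝ) : ℂ)) ρ :=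
        analyticAt_id.cpow analyticAt_const hs1
      have ha2 : AnalyticAt ℂ (fun z : ℂ => (1 - z) ^ (((s - 1)⁻¹ : ℝ) : ℂ)) ρ :=
        (analyticAt_const.sub analyticAt_id).cpow analyticAt_const hs2
      have hn1 : (ρ : ℂ) ^ (((s - 1)⁻¹ : ℝ) : ℂ) ≠ 0 :=
        (Complex.cpow_ne_zero_iff_of_exponent_ne_zero
          (by exact_mod_cast (inv_pos.2 (sub_pos.2 hs)).ne')).2 (slitPlane_ne_zero hs1)
      have hn2 : (1 - ρ : ℂ) ^ (((s - 1)⁻¹ : ℝ) : ℂ) ≠ 0 :=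
        (Complex.cpow_ne_zero_iff_of_exponent_ne_zero
          (by exact_mod_cast (inv_pos.2 (sub_pos.2 hs)).ne')).2 (slitPlane_ne_zero hs2)
      have he1 := (analyticAt_const (v := -(M : ℂ)).div ha1 hn1).cexp
      have he2 := (analyticAt_const (v := -(M : ℂ)).div ha2 hn2).cexp
      refine he2.div (he1.add he2) ?_
      have : (Complex.exp (-M / ρ ^ (((s - 1)⁻¹ : ℝ) : ℂ)) +
          Complex.exp (-M / (1 - ρ) ^ (((s - 1)⁻¹ : ℝ) : ℂ))) =
          ((Real.exp (-M / ρ ^ (s - 1)⁻¹) + Real.exp (-M / (1 - ρ) ^ (s - 1)⁻¹) : ℝ) : ℂ) := by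
        push_cast
        rw [Complex.ofReal_cpow h.le, Complex.ofReal_cpow (by linarith)]
        push_cast
        rfl
      refine fun h2 => ?_
      have h3 := this.symm.trans h2
      rw [Complex.ofReal_eq_zero] at h3
      exact (add_pos (Real.exp_pos _) (Real.exp_pos _)).ne' h3
    · filter_upwards [Ioo_mem_nhds h h1] with y hy
      rw [phiStep, if_neg hy.1.not_ge, if_neg hy.2.not_ge]
      push_cast
      rw [Complex.ofReal_cpow hy.1.le, Complex.ofReal_cpow (by linarith [hy.2])]
      push_cast
      rfl
  · rw [h1]
    have h2 : GevreyAt s (fun ρ => ((1 - phiStep s M ρ : ℝ) : ℂ)) (-1 * 1 + 1) := by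
      norm_num
      simpa using h0
    refine h2.comp_affine.congr (.of_forall fun y => ?_)
    simp only [show -1 * y + 1 = 1 - y by ring, phiStep_one_sub]
    simp
  · refine (gevreyAt_const s 0 ρ (by linarith)).congr ?_
    filter_upwards [Ioi_mem_nhds h1] with y hy
    have hy' : 1 < y := hy
    simp [phiStep, hy'.le, (by linarith : ¬ y ≤ 0)]

/-- The set of pairs `(t, z)` with `t` in the open right half-plane. -/
def rightHalf : Set (ℂ × ℂ) := {p | 0 < p.1.re}

theorem isOpen_rightHalf : IsOpen rightHalf :=
  isOpen_lt continuous_const (Complex.continuous_re.comp continuous_fst)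

/-- The derivative of `G` in the direction `v`. -/
noncomputable def dirDeriv (v : ℂ × ℂ) (G : ℂ × ℂ → ℂ) : ℂ × ℂ → ℂ := fun p => fderiv ℂ G p v

theorem ContDiffOn.dirDeriv {G : ℂ × ℂ → ℂ} {V : Set (ℂ × ℂ)} (hV : IsOpen V)
    (hG : ContDiffOn ℂ ∞ G V) (v : ℂ × ℂ) : ContDiffOn ℂ ∞ (dirDeriv v G) V :=
  (hG.fderiv_of_isOpen hV (m := ∞) (by simp)).clm_apply contDiffOn_const

theorem ContDiffOn.dirDeriv_iterate {G : ℂ × ℂ → ℂ} {V : Set (ℂ × ℂ)} (hV : IsOpen V)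
    (hG : ContDiffOn ℂ ∞ G V) (v : ℂ × ℂ) (n : ℕ) :
    ContDiffOn ℂ ∞ ((_root_.dirDeriv v)^[n] G) V := by
  induction n with
  | zero => exact hG
  | succ n ih => rw [Function.iterate_succ_apply']; exact ContDiffOn.dirDeriv hV ih v

theorem dirDeriv_congr {G G' : ℂ × ℂ → ℂ} {V : Set (ℂ × ℂ)} (hV : IsOpen V) (h : EqOn G G' V)
    (v : ℂ × ℂ) : EqOn (dirDeriv v G) (dirDeriv v G') V := by
  intro p hp
  have : G =ᶠ[𝓝 p] G' := by filter_upwards [hV.mem_nhds hp] with q hq using h hq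
  simp only [dirDeriv, this.fderiv_eq]

theorem dirDeriv_iterate_congr {G G' : ℂ × ℂ → ℂ} {V : Set (ℂ × ℂ)} (hV : IsOpen V)
    (h : EqOn G G' V) (v : ℂ × ℂ) (n : ℕ) : EqOn ((dirDeriv v)^[n] G) ((dirDeriv v)^[n] G') V := by
  induction n with
  | zero => exact h
  | succ n ih => simp only [Function.iterate_succ_apply']; exact dirDeriv_congr hV ih v

theorem dirDeriv_const_smul (c : ℂ) (G : ℂ × ℂ → ℂ) (v : ℂ × ℂ) :
    dirDeriv v (c • G) = c • dirDeriv v G := by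
  ext p
  simp [dirDeriv, fderiv_const_smul_field]

theorem dirDeriv_iterate_const_smul (c : ℂ) (G : ℂ × ℂ → ℂ) (v : ℂ × ℂ) (n : ℕ) :
    (dirDeriv v)^[n] (c • G) = c • (dirDeriv v)^[n] G := by
  induction n with
  | zero => rfl
  | succ n ih => simp only [Function.iterate_succ_apply', ih, dirDeriv_const_smul]

theorem dirDeriv_comm {G : ℂ × ℂ → ℂ} {V : Set (ℂ × ℂ)} (hV : IsOpen V)
    (hG : ContDiffOn ℂ ∞ G V) (v w : ℂ × ℂ) :
    EqOn (dirDeriv v (dirDeriv w G)) (dirDeriv w (dirDeriv v G)) V := by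
  intro p hp
  have h1 : DifferentiableAt ℂ (fderiv ℂ G) p :=
    ((hG.fderiv_of_isOpen hV (m := ∞) (by simp)).differentiableOn (by simp)).differentiableAt
      (hV.mem_nhds hp)
  have h2 : IsSymmSndFDerivAt ℂ G p :=
    (hG.contDiffAt (hV.mem_nhds hp)).isSymmSndFDerivAt (by simp; exact WithTop.coe_le_coe.2 le_top)
  have h3 : ∀ u u' : ℂ × ℂ, dirDeriv u (dirDeriv u' G) p = fderiv ℂ (fderiv ℂ G) p u u' := by
    intro u u'
    have : HasFDerivAt (dirDeriv u' G)
        ((ContinuousLinearMap.apply ℂ ℂ u').comp (fderiv ℂ (fderiv ℂ G) p)) p :=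
      (ContinuousLinearMap.apply ℂ ℂ u').hasFDerivAt.comp p h1.hasFDerivAt
    rw [dirDeriv, this.fderiv]; rfl
  rw [h3, h3, h2.eq]

/-- Smooth solutions on the right half-plane of `∂ₓ² G = -i ∂ₜ G`. -/
def IsSchrodingerSol (G : ℂ × ℂ → ℂ) : Prop :=
  ContDiffOn ℂ ∞ G rightHalf ∧
    EqOn (dirDeriv (0, 1) (dirDeriv (0, 1) G)) ((-Complex.I) • dirDeriv (1, 0) G) rightHalf

theorem IsSchrodingerSol.dirDeriv {G : ℂ × ℂ → ℂ} (hG : IsSchrodingerSol G) (v : ℂ × ℂ) :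
    IsSchrodingerSol (dirDeriv v G) := by
  have hV := isOpen_rightHalf
  refine ⟨ContDiffOn.dirDeriv hV hG.1 v, ?_⟩
  have h1 := dirDeriv_congr hV (dirDeriv_comm hV hG.1 (0, 1) v) (0, 1)
  have h2 := dirDeriv_comm hV (ContDiffOn.dirDeriv hV hG.1 (0, 1)) (0, 1) v
  have h3 := dirDeriv_congr hV hG.2 v
  rw [dirDeriv_const_smul] at h3
  have h4 := dirDeriv_comm hV hG.1 v (1, 0)
  intro p hp
  rw [h1 hp, h2 hp, h3 hp, Pi.smul_apply, Pi.smul_apply, h4 hp]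

theorem IsSchrodingerSol.dirDeriv_iterate_two_mul (j : ℕ) : ∀ {G : ℂ × ℂ → ℂ},
    IsSchrodingerSol G → EqOn ((_root_.dirDeriv (0, 1))^[2 * j] G)
      ((-Complex.I) ^ j • (_root_.dirDeriv (1, 0))^[j] G) rightHalf := by
  induction j with
  | zero => intro G _ p _; simp
  | succ j ih =>
    intro G hG p hp
    rw [show 2 * (j + 1) = 2 * j + 1 + 1 by ring, Function.iterate_succ_apply,
      Function.iterate_succ_apply,
      dirDeriv_iterate_congr isOpen_rightHalf hG.2 (0, 1) (2 * j) hp,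
      dirDeriv_iterate_const_smul, Pi.smul_apply, ih (hG.dirDeriv (1, 0)) hp, pow_succ',
      Function.iterate_succ_apply, Pi.smul_apply, Pi.smul_apply, smul_smul]

/-- The Schrödinger kernel with complex arguments. -/
noncomputable def schroKernel (p : ℂ × ℂ) : ℂ :=
  Complex.exp (Complex.I * p.2 ^ 2 / (4 * p.1)) /
    ((4 * (Real.pi : ℂ) * Complex.I * p.1) ^ ((1 : ℂ) / 2))

theorem mem_slitPlane_of_rightHalf {t : ℂ} (ht : 0 < t.re) :
    4 * (Real.pi : ℂ) * Complex.I * t ∈ slitPlane := by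
  right
  have : (4 * (Real.pi : ℂ) * Complex.I * t).im = 4 * Real.pi * t.re := by
    simp [Complex.mul_re, Complex.mul_im]
  rw [this]
  positivity

theorem contDiffOn_schroKernel : ContDiffOn ℂ ∞ schroKernel rightHalf := by
  intro p hp
  have hp' : p.1 ≠ 0 := by
    rintro h
    simp [rightHalf, h] at hp
  have hs := mem_slitPlane_of_rightHalf hp
  refine ContDiffAt.contDiffWithinAt (ContDiffAt.div ?_ ?_ ?_)
  · refine ContDiffAt.cexp (ContDiffAt.div (by fun_prop) (by fun_prop) (by simpa using hp'))
  · have : AnalyticAt ℂ (fun p : ℂ × ℂ => (4 * (Real.pi : ℂ) * Complex.I * p.1) ^ ((1 : ℂ) / 2))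
        p := AnalyticAt.cpow (analyticAt_const.mul analyticAt_fst) analyticAt_const hs
    exact this.contDiffAt
  · exact (Complex.cpow_ne_zero_iff_of_exponent_ne_zero (by norm_num)).2 (slitPlane_ne_zero hs)

theorem hasDerivAt_snd_of_contDiffOn {G : ℂ × ℂ → ℂ} (hG : ContDiffOn ℂ ∞ G rightHalf) {t : ℂ}
    (ht : 0 < t.re) (x : ℂ) :
    HasDerivAt (fun x => G (t, x)) (dirDeriv (0, 1) G (t, x)) x := by
  have h1 : HasFDerivAt G (fderiv ℂ G (t, x)) (t, x) :=
    ((hG.differentiableOn (by simp)).differentiableAt (x := (t, x))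
      (isOpen_rightHalf.mem_nhds ht)).hasFDerivAt
  exact h1.comp_hasDerivAt x ((hasDerivAt_const x t).prodMk (hasDerivAt_id x))

theorem hasDerivAt_fst_of_contDiffOn {G : ℂ × ℂ → ℂ} (hG : ContDiffOn ℂ ∞ G rightHalf) {t : ℂ}
    (ht : 0 < t.re) (x : ℂ) :
    HasDerivAt (fun t => G (t, x)) (dirDeriv (1, 0) G (t, x)) t := by
  have h1 : HasFDerivAt G (fderiv ℂ G (t, x)) (t, x) :=
    ((hG.differentiableOn (by simp)).differentiableAt (x := (t, x))
      (isOpen_rightHalf.mem_nhds ht)).hasFDerivAt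
  exact h1.comp_hasDerivAt t ((hasDerivAt_id t).prodMk (hasDerivAt_const t x))

theorem hasDerivAt_schroKernel_snd (t x : ℂ) :
    HasDerivAt (fun x => schroKernel (t, x))
      (schroKernel (t, x) * (Complex.I * x / (2 * t))) x := by
  simp only [schroKernel]
  have h1 : HasDerivAt (fun x : ℂ => Complex.I * x ^ 2 / (4 * t))
      (Complex.I * x / (2 * t)) x := by
    refine (((hasDerivAt_pow 2 x).const_mul Complex.I).div_const (4 * t)).congr_deriv ?_
    by_cases ht : t = 0
    · simp [ht]
    · field_simp; ring
  refine (h1.cexp.div_const _).congr_deriv ?_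
  ring

theorem hasDerivAt_schroKernel_fst {t : ℂ} (ht : 0 < t.re) (x : ℂ) :
    HasDerivAt (fun t => schroKernel (t, x))
      (schroKernel (t, x) * (-(Complex.I * x ^ 2 / (4 * t ^ 2)) - 1 / (2 * t))) t := by
  unfold schroKernel
  have ht0 : t ≠ 0 := by rintro rfl; simp at ht
  have hs := mem_slitPlane_of_rightHalf ht
  have hsn := slitPlane_ne_zero hs
  have hc := (Complex.cpow_ne_zero_iff_of_exponent_ne_zero
    (x := 4 * (Real.pi : ℂ) * Complex.I * t) (y := (1 : ℂ) / 2) (by norm_num)).2 hsn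
  have h1 : HasDerivAt (fun t : ℂ => Complex.I * x ^ 2 / (4 * t))
      (-(Complex.I * x ^ 2 / (4 * t ^ 2))) t := by
    refine ((hasDerivAt_const t (Complex.I * x ^ 2)).div ((hasDerivAt_id t).const_mul 4)
      (by simpa using ht0)).congr_deriv ?_
    simp; field_simp
  have h2 : HasDerivAt (fun t : ℂ => (4 * (Real.pi : ℂ) * Complex.I * t) ^ ((1 : ℂ) / 2))
      ((4 * (Real.pi : ℂ) * Complex.I * t) ^ ((1 : ℂ) / 2) * (1 / (2 * t))) t := by
    refine (((hasDerivAt_id t).const_mul (4 * (Real.pi : ℂ) * Complex.I)).cpow_const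
      (c := (1 : ℂ) / 2) hs).congr_deriv ?_
    rw [id, Complex.cpow_sub _ _ hsn, Complex.cpow_one]
    field_simp
  refine (h1.cexp.div h2 hc).congr_deriv ?_
  field_simp

theorem isSchrodingerSol_schroKernel : IsSchrodingerSol schroKernel := by
  have hK := contDiffOn_schroKernel
  refine ⟨hK, fun p hp => ?_⟩
  obtain ⟨t, x⟩ := p
  have ht : 0 < t.re := hp
  have ht0 : t ≠ 0 := by rintro rfl; simp at ht
  have h1 : ∀ y : ℂ, dirDeriv (0, 1) schroKernel (t, y) =
      schroKernel (t, y) * (Complex.I * y / (2 * t)) := fun y =>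
    (hasDerivAt_snd_of_contDiffOn hK ht y).unique (hasDerivAt_schroKernel_snd t y)
  have h2 := (hasDerivAt_fst_of_contDiffOn hK ht x).unique (hasDerivAt_schroKernel_fst ht x)
  have h3 := hasDerivAt_snd_of_contDiffOn (ContDiffOn.dirDeriv isOpen_rightHalf hK (0, 1)) ht x
  simp only [h1] at h3
  have h4 := (hasDerivAt_schroKernel_snd t x).mul
      (((hasDerivAt_id x).const_mul Complex.I).div_const (2 * t))
  rw [h3.unique h4, Pi.smul_apply, h2, smul_eq_mul]
  simp only [id]
  field_simp
  ring_nf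

/-- Superposition of the translates of `G` in its second variable by `y ∈ (-2, 2)`, with
weights `f y`. -/
noncomputable def superpose {F : Type*} [NormedAddCommGroup F] [NormedSpace ℂ F] (f : ℝ → ℂ)
    (G : ℂ × ℂ → F) (p : ℂ × ℂ) : F :=
  ∫ y in Ioo (-2 : ℝ) 2, f y • G (p - (0, (y : ℂ)))

theorem exists_bound_translates {F : Type*} [NormedAddCommGroup F] {G : ℂ × ℂ → F}
    (hG : ContinuousOn G rightHalf) {p : ℂ × ℂ} (hp : p ∈ rightHalf) :
    ∃ r > 0, ∃ B, ∀ q ∈ Metric.closedBall p r, ∀ y ∈ Icc (-2 : ℝ) 2,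
      q - (0, (y : ℂ)) ∈ rightHalf ∧ ‖G (q - (0, (y : ℂ)))‖ ≤ B := by
  obtain ⟨r, hr, hrp⟩ := Metric.nhds_basis_closedBall.mem_iff.1 (isOpen_rightHalf.mem_nhds hp)
  have hK : IsCompact ((fun a : (ℂ × ℂ) × ℝ => a.1 - (0, (a.2 : ℂ))) ''
      (Metric.closedBall p r ×ˢ Icc (-2 : ℝ) 2)) :=
    ((isCompact_closedBall p r).prod isCompact_Icc).image (by fun_prop)
  have hsub : ((fun a : (ℂ × ℂ) × ℝ => a.1 - (0, (a.2 : ℂ))) ''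
      (Metric.closedBall p r ×ˢ Icc (-2 : ℝ) 2)) ⊆ rightHalf := by
    rintro _ ⟨⟨q, y⟩, ⟨hq, -⟩, rfl⟩
    have := hrp hq
    simpa [rightHalf] using this
  obtain ⟨B, hB⟩ := hK.exists_bound_of_continuousOn (hG.mono hsub)
  refine ⟨r, hr, B, fun q hq y hy => ?_⟩
  have hm := mem_image_of_mem (fun a : (ℂ × ℂ) × ℝ => a.1 - (0, (a.2 : ℂ)))
    (mk_mem_prod hq hy)
  exact ⟨hsub hm, hB _ hm⟩

theorem aestronglyMeasurable_translates {F : Type*} [NormedAddCommGroup F] [NormedSpace ℂ F]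
    {f : ℝ → ℂ} (hf : IntegrableOn f (Ioo (-2) 2)) {G : ℂ × ℂ → F}
    (hG : ContinuousOn G rightHalf) {p : ℂ × ℂ} (hp : p ∈ rightHalf) :
    AEStronglyMeasurable (fun y : ℝ => f y • G (p - (0, (y : ℂ))))
      (volume.restrict (Ioo (-2 : ℝ) 2)) := by
  refine hf.1.smul (Continuous.aestronglyMeasurable ?_)
  refine hG.comp_continuous (by fun_prop) fun y => ?_
  simpa [rightHalf] using hp

theorem hasFDerivAt_superpose {F : Type*} [NormedAddCommGroup F] [NormedSpace ℂ F]
    [CompleteSpace F] {f : ℝ → ℂ} (hf : IntegrableOn f (Ioo (-2) 2)) {G : ℂ × ℂ → F}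
    (hG : ContDiffOn ℂ 1 G rightHalf) {p : ℂ × ℂ} (hp : p ∈ rightHalf) :
    HasFDerivAt (superpose f G) (superpose f (fderiv ℂ G) p) p := by
  have hG' : ContinuousOn (fderiv ℂ G) rightHalf :=
    hG.continuousOn_fderiv_of_isOpen isOpen_rightHalf le_rfl
  obtain ⟨r, hr, B, hB⟩ := exists_bound_translates hG' hp
  obtain ⟨r', hr', B', hB'⟩ := exists_bound_translates hG.continuousOn hp
  unfold superpose
  refine (hasFDerivAt_integral_of_dominated_of_fderiv_le (𝕜 := ℂ)
    (F := fun q y => f y • G (q - (0, (y : ℂ))))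
    (F' := fun q y => f y • fderiv ℂ G (q - (0, (y : ℂ))))
    (bound := fun y => ‖f y‖ * B) (s := Metric.ball p r) (Metric.ball_mem_nhds p hr)
    ?_ ?_ ?_ ?_ ?_ ?_)
  · filter_upwards [isOpen_rightHalf.mem_nhds hp] with q hq
    exact aestronglyMeasurable_translates hf hG.continuousOn hq
  · refine (hf.norm.mul_const B').mono' (aestronglyMeasurable_translates hf hG.continuousOn hp) ?_
    filter_upwards [ae_restrict_mem measurableSet_Ioo] with y hy
    rw [norm_smul]
    exact mul_le_mul_of_nonneg_left
      (hB' p (Metric.mem_closedBall_self hr'.le) y (Ioo_subset_Icc_self hy)).2 (norm_nonneg _)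
  · exact aestronglyMeasurable_translates hf hG' hp
  · filter_upwards [ae_restrict_mem measurableSet_Ioo] with y hy q hq
    rw [norm_smul]
    exact mul_le_mul_of_nonneg_left
      (hB q (Metric.ball_subset_closedBall hq) y (Ioo_subset_Icc_self hy)).2 (norm_nonneg _)
  · exact hf.norm.mul_const B
  · filter_upwards [ae_restrict_mem measurableSet_Ioo] with y hy q hq
    have hm := (hB q (Metric.ball_subset_closedBall hq) y (Ioo_subset_Icc_self hy)).1
    have h1 := ((hG.differentiableOn one_ne_zero).differentiableAt
      (isOpen_rightHalf.mem_nhds hm)).hasFDerivAt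
    exact (h1.comp q ((hasFDerivAt_id q).sub_const (0, (y : ℂ)))).const_smul (f y)

theorem contDiffOn_superpose {f : ℝ → ℂ} (hf : IntegrableOn f (Ioo (-2) 2)) (n : ℕ) :
    ∀ {F : Type} [NormedAddCommGroup F] [NormedSpace ℂ F] [CompleteSpace F] {G : ℂ × ℂ → F},
      ContDiffOn ℂ ∞ G rightHalf → ContDiffOn ℂ n (superpose f G) rightHalf := by
  induction n with
  | zero =>
    intro F _ _ _ G hG
    refine contDiffOn_zero.2 fun p hp => ?_
    exact (hasFDerivAt_superpose hf (hG.of_le (by simp)) hp).continuousAt.continuousWithinAt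
  | succ n ih =>
    intro F _ _ _ G hG
    rw [Nat.cast_succ, contDiffOn_succ_iff_fderiv_of_isOpen isOpen_rightHalf]
    have hd := fun p hp => hasFDerivAt_superpose (p := p) hf (hG.of_le (by simp)) hp
    refine ⟨fun p hp => (hd p hp).differentiableAt.differentiableWithinAt, by simp, ?_⟩
    exact (ih (hG.fderiv_of_isOpen isOpen_rightHalf (m := ∞) (by simp))).congr
      fun p hp => (hd p hp).fderiv

theorem dirDeriv_superpose {f : ℝ → ℂ} (hf : IntegrableOn f (Ioo (-2) 2)) {G : ℂ × ℂ → ℂ}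
    (hG : ContDiffOn ℂ ∞ G rightHalf) (v : ℂ × ℂ) :
    EqOn (dirDeriv v (superpose f G)) (superpose f (dirDeriv v G)) rightHalf := by
  intro p hp
  have hG' : ContinuousOn (fderiv ℂ G) rightHalf :=
    hG.continuousOn_fderiv_of_isOpen isOpen_rightHalf (by simp)
  obtain ⟨r, hr, B, hB⟩ := exists_bound_translates hG' hp
  rw [dirDeriv, (hasFDerivAt_superpose hf (hG.of_le (by simp)) hp).fderiv, superpose,
    ContinuousLinearMap.integral_apply]
  · rfl
  · refine (hf.norm.mul_const B).mono' (aestronglyMeasurable_translates hf hG' hp) ?_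
    filter_upwards [ae_restrict_mem measurableSet_Ioo] with y hy
    rw [norm_smul]
    exact mul_le_mul_of_nonneg_left
      (hB p (Metric.mem_closedBall_self hr.le) y (Ioo_subset_Icc_self hy)).2 (norm_nonneg _)

theorem IsSchrodingerSol.superpose {f : ℝ → ℂ} (hf : IntegrableOn f (Ioo (-2) 2))
    {G : ℂ × ℂ → ℂ} (hG : IsSchrodingerSol G) : IsSchrodingerSol (superpose f G) := by
  refine ⟨contDiffOn_infty.2 fun n => contDiffOn_superpose hf n hG.1, fun p hp => ?_⟩
  rw [dirDeriv_congr isOpen_rightHalf (dirDeriv_superpose hf hG.1 _) _ hp,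
    dirDeriv_superpose hf (hG.dirDeriv _).1 _ hp, Pi.smul_apply,
    dirDeriv_superpose hf hG.1 _ hp, _root_.superpose, _root_.superpose, ← integral_smul]
  refine integral_congr_ae (ae_of_all _ fun y => ?_)
  have hm : p - (0, (y : ℂ)) ∈ rightHalf := by simpa [rightHalf] using hp
  simp only [hG.2 hm, Pi.smul_apply, smul_eq_mul]
  ring

theorem iteratedDeriv_snd_of_contDiffOn (n : ℕ) {G : ℂ × ℂ → ℂ}
    (hG : ContDiffOn ℂ ∞ G rightHalf) {t : ℂ} (ht : 0 < t.re) :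
    iteratedDeriv n (fun x => G (t, x)) = fun x => (dirDeriv (0, 1))^[n] G (t, x) := by
  induction n with
  | zero => simp
  | succ n ih =>
    rw [iteratedDeriv_succ, ih]
    ext x
    rw [(hasDerivAt_snd_of_contDiffOn (hG.dirDeriv_iterate isOpen_rightHalf (0, 1) n) ht x).deriv,
      Function.iterate_succ_apply']

theorem iteratedDeriv_fst_of_contDiffOn (n : ℕ) {G : ℂ × ℂ → ℂ}
    (hG : ContDiffOn ℂ ∞ G rightHalf) (x : ℂ) :
    ∀ t : ℂ, 0 < t.re →
      iteratedDeriv n (fun t => G (t, x)) t = (dirDeriv (1, 0))^[n] G (t, x) := by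
  induction n with
  | zero => simp
  | succ n ih =>
    intro t ht
    have h : iteratedDeriv n (fun t => G (t, x)) =ᶠ[𝓝 t]
        fun t => (dirDeriv (1, 0))^[n] G (t, x) := by
      filter_upwards [(isOpen_lt continuous_const Complex.continuous_re).mem_nhds ht] with z hz
      exact ih z hz
    rw [iteratedDeriv_succ, h.deriv_eq,
      (hasDerivAt_fst_of_contDiffOn (hG.dirDeriv_iterate isOpen_rightHalf (1, 0) n) ht x).deriv,
      Function.iterate_succ_apply']

/-- The boundary trace `∂ₓ G (t, 0)`. -/
noncomputable def normalTrace (G : ℂ × ℂ → ℂ) (t : ℂ) : ℂ := dirDeriv (0, 1) G (t, 0)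

theorem analyticAt_normalTrace {G : ℂ × ℂ → ℂ} (hG : ContDiffOn ℂ ∞ G rightHalf) {t : ℂ}
    (ht : 0 < t.re) : AnalyticAt ℂ (normalTrace G) t := by
  refine DifferentiableOn.analyticAt (s := {t : ℂ | 0 < t.re}) (fun z hz => ?_)
    ((isOpen_lt continuous_const Complex.continuous_re).mem_nhds ht)
  exact (hasDerivAt_fst_of_contDiffOn (hG.dirDeriv isOpen_rightHalf (0, 1)) hz
    0).differentiableAt.differentiableWithinAt

theorem iteratedDeriv_eq_zero_of_odd {g : ℂ → ℂ} (hg : ∀ x, g (-x) = -g x) {n : ℕ} (hn : Even n) :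
    iteratedDeriv n g 0 = 0 := by
  have h := iteratedDeriv_comp_neg n g 0
  simp only [hg, neg_zero, hn.neg_one_pow, one_smul] at h
  rw [show (fun x => -g x) = -g from rfl, iteratedDeriv_neg] at h
  linear_combination (-1 / 2 : ℂ) * h

theorem hasSum_of_odd_schrodingerSol {G : ℂ × ℂ → ℂ} (hG : IsSchrodingerSol G) {t : ℂ}
    (ht : 0 < t.re) (hodd : ∀ x, G (t, -x) = -G (t, x)) (x : ℂ) :
    HasSum (fun j : ℕ => (-Complex.I) ^ j * x ^ (2 * j + 1) / ((2 * j + 1).factorial : ℂ) *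
      iteratedDeriv j (normalTrace G) t) (G (t, x)) := by
  have hd : Differentiable ℂ (fun x => G (t, x)) := fun x =>
    (hasDerivAt_snd_of_contDiffOn hG.1 ht x).differentiableAt
  have h := Complex.hasSum_taylorSeries_of_entire hd 0 x
  have hinj : Function.Injective (fun j : ℕ => 2 * j + 1) := fun a b hab => by
    simpa using hab
  rw [← hinj.hasSum_iff] at h
  · refine h.congr_fun fun j => ?_
    have h1 := (hG.dirDeriv (0, 1)).dirDeriv_iterate_two_mul j
      (show ((t, 0) : ℂ × ℂ) ∈ rightHalf from ht)
    simp only [Function.comp_apply, smul_eq_mul, sub_zero]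
    rw [iteratedDeriv_snd_of_contDiffOn _ hG.1 ht, Function.iterate_succ_apply]
    beta_reduce
    rw [h1, Pi.smul_apply, smul_eq_mul,
      show normalTrace G = fun t => dirDeriv (0, 1) G (t, 0) from rfl,
      iteratedDeriv_fst_of_contDiffOn j (hG.dirDeriv (0, 1)).1 0 t ht]
    ring
  · intro n hn
    have he : Even n := by
      rcases Nat.even_or_odd' n with ⟨k, hk | hk⟩
      · exact ⟨k, by omega⟩
      · exact absurd ⟨k, hk.symm⟩ hn
    rw [iteratedDeriv_eq_zero_of_odd hodd he, smul_zero, smul_zero]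

theorem thetaOdd_of_notMem (θ₀ : ℝ → ℂ) {x : ℝ} (hx : x ∉ Ioo (-1 : ℝ) 1) :
    thetaOdd θ₀ x = 0 := by
  rw [thetaOdd, if_neg fun h => hx ⟨by linarith, h.2⟩, if_neg fun h => hx ⟨h.1, by linarith⟩]

theorem thetaMinus_eq_superpose (θ₀ : ℝ → ℂ) (t x : ℝ) :
    thetaMinus θ₀ t x = superpose (thetaOdd θ₀) schroKernel ((t : ℂ), (x : ℂ)) := by
  have h := setIntegral_eq_of_subset_of_forall_sdiff_eq_zero (μ := volume)
    (f := fun y => E t (x - y) * thetaOdd θ₀ y) (s := Ioo (-1 : ℝ) 1) (t := Ioo (-2 : ℝ) 2)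
    measurableSet_Ioo (Ioo_subset_Ioo (by norm_num) (by norm_num)) fun y hy => by
      rw [thetaOdd_of_notMem θ₀ hy.2, mul_zero]
  rw [thetaMinus, ← h, superpose]
  refine integral_congr_ae (ae_of_all _ fun y => ?_)
  simp only [E, schroKernel, Prod.mk_sub_mk, sub_zero, smul_eq_mul, Complex.ofReal_sub, mul_comm]

theorem thetaOdd_neg (θ₀ : ℝ → ℂ) (x : ℝ) : thetaOdd θ₀ (-x) = -thetaOdd θ₀ x := by
  unfold thetaOdd
  by_cases h1 : 0 < x ∧ x < 1
  · rw [if_pos h1, if_neg (by intro h; linarith [h.1, h1.1]), if_pos (by constructor <;> linarith),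
      neg_neg]
  · rw [if_neg h1]
    by_cases h2 : -1 < x ∧ x < 0
    · rw [if_pos h2, if_pos (by constructor <;> linarith), neg_neg]
    · rw [if_neg h2, if_neg, if_neg, neg_zero]
      · intro h; exact h1 ⟨by linarith, by linarith⟩
      · intro h; exact h2 ⟨by linarith, by linarith⟩

theorem superpose_neg {f : ℝ → ℂ} (hf : ∀ y, f (-y) = -f y) {G : ℂ × ℂ → ℂ} {t : ℂ}
    (hG : ∀ x, G (t, -x) = G (t, x)) (x : ℂ) : superpose f G (t, -x) = -superpose f G (t, x) := by
  simp only [superpose, Prod.mk_sub_mk, sub_zero, ← integral_Ioc_eq_integral_Ioo]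
  rw [← intervalIntegral.integral_of_le (by norm_num),
    ← intervalIntegral.integral_of_le (by norm_num),
    ← intervalIntegral.integral_neg]
  have h := intervalIntegral.integral_comp_neg (a := (-2 : ℝ)) (b := 2)
    (fun y : ℝ => f y • G (t, -x - (y : ℂ)))
  rw [neg_neg] at h
  rw [← h]
  refine intervalIntegral.integral_congr fun y _ => ?_
  simp only [hf, ← hG (-x - ((-y : ℝ) : ℂ)), smul_eq_mul]
  push_cast
  ring_nf

theorem memLp_thetaOdd {θ₀ : ℝ → ℂ} (hθ₀ : MemLp θ₀ 2 (volume.restrict (Ioo (0 : ℝ) 1))) :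
    MemLp (thetaOdd θ₀) 2 volume := by
  have h1 : MemLp ((Ioo (0 : ℝ) 1).indicator θ₀) 2 volume :=
    (memLp_indicator_iff_restrict measurableSet_Ioo).2 hθ₀
  have h2 := h1.comp_measurePreserving (Measure.measurePreserving_neg (volume : Measure ℝ))
  refine (h1.sub h2).ae_eq (ae_of_all _ fun x => ?_)
  simp only [Pi.sub_apply, Function.comp_apply, thetaOdd, indicator, mem_Ioo]
  by_cases ha : 0 < x ∧ x < 1
  · rw [if_pos ha, if_pos ha, if_neg (by intro h; linarith [h.1, ha.1]), sub_zero]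
  · rw [if_neg ha, if_neg ha, zero_sub]
    by_cases hb : -1 < x ∧ x < 0
    · rw [if_pos hb, if_pos (by constructor <;> linarith)]
    · rw [if_neg hb, if_neg, neg_zero]
      intro h; exact hb ⟨by linarith, by linarith⟩

theorem integrableOn_thetaOdd {θ₀ : ℝ → ℂ}
    (hθ₀ : MemLp θ₀ 2 (volume.restrict (Ioo (0 : ℝ) 1))) :
    IntegrableOn (thetaOdd θ₀) (Ioo (-2) 2) :=
  ((memLp_thetaOdd hθ₀).restrict _).integrable (by norm_num)

/-- The complex extension of `∂ₓ θ⁻ (t, 0)`. -/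
noncomputable def boundaryFlux (θ₀ : ℝ → ℂ) : ℂ → ℂ :=
  normalTrace (superpose (thetaOdd θ₀) schroKernel)

theorem isSchrodingerSol_thetaMinus {θ₀ : ℝ → ℂ}
    (hθ₀ : MemLp θ₀ 2 (volume.restrict (Ioo (0 : ℝ) 1))) :
    IsSchrodingerSol (superpose (thetaOdd θ₀) schroKernel) :=
  isSchrodingerSol_schroKernel.superpose (integrableOn_thetaOdd hθ₀)

theorem analyticAt_boundaryFlux {θ₀ : ℝ → ℂ}
    (hθ₀ : MemLp θ₀ 2 (volume.restrict (Ioo (0 : ℝ) 1))) {t : ℂ} (ht : 0 < t.re) :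
    AnalyticAt ℂ (boundaryFlux θ₀) t :=
  analyticAt_normalTrace (isSchrodingerSol_thetaMinus hθ₀).1 ht

theorem deriv_thetaMinus_zero {θ₀ : ℝ → ℂ}
    (hθ₀ : MemLp θ₀ 2 (volume.restrict (Ioo (0 : ℝ) 1))) {t : ℝ} (ht : 0 < t) :
    deriv (fun x => thetaMinus θ₀ t x) 0 = boundaryFlux θ₀ t := by
  have h := hasDerivAt_snd_of_contDiffOn (isSchrodingerSol_thetaMinus hθ₀).1 (t := (t : ℂ))
    (by simpa using ht) ((0 : ℝ) : ℂ)
  have h2 := h.comp_ofReal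
  simp only [← thetaMinus_eq_superpose] at h2
  rw [h2.deriv, boundaryFlux, normalTrace, Complex.ofReal_zero]

theorem hasSum_thetaMinus {θ₀ : ℝ → ℂ}
    (hθ₀ : MemLp θ₀ 2 (volume.restrict (Ioo (0 : ℝ) 1))) {t : ℝ} (ht : 0 < t) (x : ℝ) :
    HasSum (fun j : ℕ => (-Complex.I) ^ j * (x : ℂ) ^ (2 * j + 1) / ((2 * j + 1).factorial : ℂ) *
      iteratedDeriv j (boundaryFlux θ₀) (t : ℂ)) (thetaMinus θ₀ t x) := by
  rw [thetaMinus_eq_superpose]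
  refine hasSum_of_odd_schrodingerSol (isSchrodingerSol_thetaMinus hθ₀) (by simpa using ht) ?_ _
  exact superpose_neg (thetaOdd_neg θ₀) fun x => by simp [schroKernel]

theorem exists_gevrey_bound_of_isCompact {s : ℝ} {f : ℝ → ℂ} {S : Set ℝ} (hS : IsCompact S)
    (hf : ∀ x ∈ S, GevreyAt s f x) :
    ∃ C K : ℝ, 0 < C ∧ 1 ≤ K ∧ ∀ x ∈ S, ∀ n : ℕ,
      ‖iteratedDeriv n f x‖ ≤ C * (n.factorial : ℝ) ^ s * K ^ n := by
  refine hS.induction_on (p := fun S => ∃ C K : ℝ, 0 < C ∧ 1 ≤ K ∧ ∀ x ∈ S, ∀ n : ℕ,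
      ‖iteratedDeriv n f x‖ ≤ C * (n.factorial : ℝ) ^ s * K ^ n) ⟨1, 1, one_pos, le_rfl, by simp⟩
    ?_ ?_ ?_
  · rintro S S' hSS ⟨C, K, hC, hK, h⟩
    exact ⟨C, K, hC, hK, fun x hx => h x (hSS hx)⟩
  · rintro S S' ⟨C, K, hC, hK, h⟩ ⟨C', K', hC', hK', h'⟩
    refine ⟨max C C', max K K', lt_max_of_lt_left hC, le_max_of_le_left hK, ?_⟩
    rintro x (hx | hx) n
    · refine (h x hx n).trans ?_
      gcongr
      · exact le_max_left _ _
      · exact le_max_left _ _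
    · refine (h' x hx n).trans ?_
      gcongr
      · exact le_max_right _ _
      · exact le_max_right _ _
  · intro x hx
    obtain ⟨C, K, hC, hK, h⟩ := hf x hx
    exact ⟨_, mem_nhdsWithin_of_mem_nhds h, C, K, hC, hK, fun y hy n => (hy n).2⟩

/-- The `q`-th derivative of `x ↦ x ^ k / k!`. -/
noncomputable def dividedPow (k q : ℕ) (x : ℝ) : ℝ :=
  if q ≤ k then x ^ (k - q) / ((k - q).factorial : ℝ) else 0

theorem hasDerivAt_dividedPow (k q : ℕ) (x : ℝ) :
    HasDerivAt (dividedPow k q) (dividedPow k (q + 1) x) x := by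
  unfold dividedPow
  by_cases h : q + 1 ≤ k
  · obtain ⟨m, rfl⟩ := Nat.exists_eq_add_of_le h
    have h1 : q + 1 + m - q = m + 1 := by omega
    have h2 : q + 1 + m - (q + 1) = m := by omega
    simp only [h1, h2, show q ≤ q + 1 + m by omega, if_true, h]
    refine ((hasDerivAt_pow (m + 1) x).div_const _).congr_deriv ?_
    rw [Nat.factorial_succ]
    push_cast
    have : (m.factorial : ℝ) ≠ 0 := by positivity
    field_simp
  · rw [if_neg h]
    by_cases h' : q ≤ k
    · have h1 : k - q = 0 := by omega
      simpa [h', h1] using hasDerivAt_const x (1 : ℝ)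
    · simpa [h'] using hasDerivAt_const x (0 : ℝ)

theorem dividedPow_add_two (k q : ℕ) : dividedPow (k + 2) (q + 2) = dividedPow k q := by
  ext x
  simp [dividedPow, Nat.add_sub_add_right]

theorem exists_pow_div_factorial_rpow_le (R : ℝ) (hR : 0 ≤ R) {α : ℝ} (hα : 0 < α) :
    ∃ D : ℝ, 0 < D ∧ ∀ k : ℕ, R ^ k ≤ D * (k.factorial : ℝ) ^ α := by
  refine ⟨Real.exp (R ^ (1 / α)) ^ α, by positivity, fun k => ?_⟩
  have hk : (0 : ℝ) < k.factorial := by positivity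
  have h1 := Real.pow_div_factorial_le_exp (R ^ (1 / α)) (by positivity) k
  rw [div_le_iff₀ hk] at h1
  have h2 := Real.rpow_le_rpow (by positivity) h1 hα.le
  rw [Real.mul_rpow (by positivity) (by positivity), ← Real.rpow_natCast, ← Real.rpow_mul hR,
    ← Real.rpow_mul hR] at h2
  rw [show 1 / α * k * α = (k : ℝ) by field_simp, Real.rpow_natCast] at h2
  exact h2

/-- The `j`-th term of the series obtained from the flatness expansion of `Y` by differentiating
`p` times in time and `q` times in space. -/
noncomputable def flatTerm (Y : ℝ → ℂ) (p q j : ℕ) (z : ℝ × ℝ) : ℂ :=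
  (-Complex.I) ^ j * (dividedPow (2 * j + 1) q z.2 : ℂ) * iteratedDeriv (j + p) Y z.1

theorem factorial_add_le (m n : ℕ) :
    (((m + n).factorial : ℕ) : ℝ) ≤ 2 ^ (m + n) * m.factorial * n.factorial := by
  rw [← Nat.add_choose_mul_factorial_mul_factorial m n]
  push_cast
  have : (((m + n).choose n : ℕ) : ℝ) ≤ 2 ^ (m + n) := by
    exact_mod_cast Nat.choose_le_two_pow (m + n) n
  gcongr

theorem factorial_sq_le (j : ℕ) : (j.factorial : ℝ) ^ 2 ≤ ((2 * j + 1).factorial : ℝ) := by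
  have h1 : j.factorial * j.factorial ≤ (j + j).factorial :=
    Nat.le_of_dvd (Nat.factorial_pos _) (Nat.factorial_mul_factorial_dvd_factorial_add j j)
  have h2 : (j + j).factorial ≤ (2 * j + 1).factorial := Nat.factorial_le (by omega)
  rw [sq]
  exact_mod_cast h1.trans h2

theorem exists_norm_flatTerm_le {s : ℝ} (hs : s ∈ Ioo (1 : ℝ) 2) {Y : ℝ → ℂ} {S : Set ℝ}
    (hS : IsCompact S) (hY : ∀ t ∈ S, GevreyAt s Y t) {B : ℝ} (hB : 0 ≤ B) :
    ∃ C L : ℝ, 0 < C ∧ 1 ≤ L ∧ ∀ p q j : ℕ, ∀ t ∈ S, ∀ x ∈ Icc (-B) B,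
      ‖flatTerm Y p q j (t, x)‖ ≤ C * (p.factorial : ℝ) ^ s * L ^ p *
        ((q.factorial : ℝ) ^ (s / 2) * L ^ q) * (1 / 2) ^ j := by
  obtain ⟨C, K, hC, hK, hCK⟩ := exists_gevrey_bound_of_isCompact hS hY
  have hs1 := hs.1
  have hs2 := hs.2
  set A := 4 * K with hA
  have hA1 : 1 ≤ A := by linarith
  obtain ⟨D, hD, hDk⟩ := exists_pow_div_factorial_rpow_le (4 * A * B) (by positivity)
    (α := 1 - s / 2) (by linarith)
  refine ⟨C * D, 4 * A, by positivity, by linarith, fun p q j t ht x hx => ?_⟩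
  have hx' : |x| ≤ B := abs_le.2 hx
  by_cases hq : q ≤ 2 * j + 1
  swap
  · simp only [flatTerm, dividedPow, if_neg hq]
    simp only [ofReal_zero, mul_zero, zero_mul, norm_zero]
    positivity
  obtain ⟨k, hk⟩ := Nat.exists_eq_add_of_le hq
  have hkk : 2 * j + 1 - q = k := by omega
  have h1 : ‖flatTerm Y p q j (t, x)‖ =
      |x| ^ k / k.factorial * ‖iteratedDeriv (j + p) Y t‖ := by
    simp only [flatTerm, dividedPow, if_pos hq, hkk, norm_mul, norm_pow, norm_neg, norm_I, one_pow,
      one_mul, norm_real, Real.norm_eq_abs, abs_div, abs_pow, Nat.abs_cast]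
  have h2 : ‖iteratedDeriv (j + p) Y t‖ ≤
      C * (A ^ (j + p) * (j.factorial : ℝ) ^ s * (p.factorial : ℝ) ^ s) := by
    refine (hCK t ht (j + p)).trans ?_
    have h3 : (((j + p).factorial : ℕ) : ℝ) ^ s ≤
        4 ^ (j + p) * (j.factorial : ℝ) ^ s * (p.factorial : ℝ) ^ s := by
      refine (Real.rpow_le_rpow (by positivity) (factorial_add_le j p) (by linarith)).trans ?_
      rw [Real.mul_rpow (by positivity) (by positivity),
        Real.mul_rpow (by positivity) (by positivity)]
      gcongr
      refine (Real.rpow_le_rpow_of_exponent_le (one_le_pow₀ (by norm_num)) hs2.le).trans ?_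
      rw [Real.rpow_two, ← pow_mul, mul_comm, pow_mul]
      norm_num
    rw [hA, mul_pow]
    calc C * (((j + p).factorial : ℕ) : ℝ) ^ s * K ^ (j + p)
        ≤ C * (4 ^ (j + p) * (j.factorial : ℝ) ^ s * (p.factorial : ℝ) ^ s) * K ^ (j + p) := by
          gcongr
      _ = _ := by ring
  have h4 : (j.factorial : ℝ) ^ s ≤
      2 ^ (q + k) * (q.factorial : ℝ) ^ (s / 2) * (k.factorial : ℝ) ^ (s / 2) := by
    have h5 : (j.factorial : ℝ) ^ s = ((j.factorial : ℝ) ^ 2) ^ (s / 2) := by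
      rw [← Real.rpow_natCast, ← Real.rpow_mul (by positivity)]
      congr 1
      push_cast
      ring
    rw [h5]
    have h6 := (factorial_sq_le j).trans ((congrArg (fun n : ℕ => (n.factorial : ℝ)) hk).le.trans
      (factorial_add_le q k))
    refine (Real.rpow_le_rpow (by positivity) h6 (by linarith)).trans ?_
    rw [Real.mul_rpow (by positivity) (by positivity),
      Real.mul_rpow (by positivity) (by positivity)]
    gcongr
    refine (Real.rpow_le_rpow_of_exponent_le (one_le_pow₀ (by norm_num))
      (show s / 2 ≤ 1 by linarith)).trans_eq (Real.rpow_one _)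
  have h7 : A ^ j ≤ (2 * A) ^ (q + k) * (1 / 2) ^ j := by
    have : A ^ j = (2 * A) ^ j * (1 / 2) ^ j := by
      rw [← mul_pow]; congr 1; ring
    rw [this]
    gcongr
    · linarith
    · omega
  have hkp : (0 : ℝ) < k.factorial := by positivity
  have h8 : (k.factorial : ℝ) ^ (1 - s / 2) * (k.factorial : ℝ) ^ (s / 2) = k.factorial := by
    rw [← Real.rpow_add hkp]; simp
  rw [h1]
  calc |x| ^ k / k.factorial * ‖iteratedDeriv (j + p) Y t‖
      ≤ B ^ k / k.factorial * (C * (A ^ p * ((2 * A) ^ (q + k) * (1 / 2) ^ j) *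
        (2 ^ (q + k) * (q.factorial : ℝ) ^ (s / 2) * (k.factorial : ℝ) ^ (s / 2)) *
        (p.factorial : ℝ) ^ s)) := by
        gcongr
        refine h2.trans ?_
        rw [pow_add, mul_comm (A ^ j)]
        gcongr
    _ = C * (p.factorial : ℝ) ^ s * A ^ p * ((q.factorial : ℝ) ^ (s / 2) * (4 * A) ^ q) *
        (1 / 2) ^ j * ((4 * A * B) ^ k * (k.factorial : ℝ) ^ (s / 2) / k.factorial) := by
        have e : (2 * A) ^ (q + k) * 2 ^ (q + k) = (4 * A) ^ q * (4 * A) ^ k := by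
          rw [← mul_pow, ← pow_add]; congr 1; ring
        rw [mul_pow (4 * A) B k]
        linear_combination (B ^ k / k.factorial * C * A ^ p * (1 / 2) ^ j *
          (q.factorial : ℝ) ^ (s / 2) * (k.factorial : ℝ) ^ (s / 2) * (p.factorial : ℝ) ^ s) * e
    _ ≤ C * (p.factorial : ℝ) ^ s * (4 * A) ^ p * ((q.factorial : ℝ) ^ (s / 2) * (4 * A) ^ q) *
        (1 / 2) ^ j * D := by
        gcongr
        · linarith
        · rw [div_le_iff₀ hkp]
          calc (4 * A * B) ^ k * (k.factorial : ℝ) ^ (s / 2)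
              ≤ D * (k.factorial : ℝ) ^ (1 - s / 2) * (k.factorial : ℝ) ^ (s / 2) := by
                gcongr; exact hDk k
            _ = _ := by rw [mul_assoc, h8]
    _ = _ := by ring

/-- The differential on `ℝ × ℝ` with given partial derivatives. -/
noncomputable def ofPartials : ℂ × ℂ →L[ℝ] (ℝ × ℝ →L[ℝ] ℂ) :=
  ((ContinuousLinearMap.smulRightL ℝ (ℝ × ℝ) ℂ (ContinuousLinearMap.fst ℝ ℝ ℝ)).comp
    (ContinuousLinearMap.fst ℝ ℂ ℂ)) +
  ((ContinuousLinearMap.smulRightL ℝ (ℝ × ℝ) ℂ (ContinuousLinearMap.snd ℝ ℝ ℝ)).comp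
    (ContinuousLinearMap.snd ℝ ℂ ℂ))

theorem ofPartials_apply (a b : ℂ) (z : ℝ × ℝ) :
    ofPartials (a, b) z = (z.1 : ℂ) * a + (z.2 : ℂ) * b := by
  simp [ofPartials]

theorem norm_ofPartials_le (a b : ℂ) : ‖ofPartials (a, b)‖ ≤ ‖a‖ + ‖b‖ := by
  refine ContinuousLinearMap.opNorm_le_bound _ (by positivity) fun z => ?_
  rw [ofPartials_apply]
  refine (norm_add_le _ _).trans ?_
  rw [norm_mul, norm_mul, norm_real, norm_real, add_mul]
  have h1 : ‖z.1‖ ≤ ‖z‖ := norm_fst_le z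
  have h2 : ‖z.2‖ ≤ ‖z‖ := norm_snd_le z
  rw [mul_comm ‖z.1‖, mul_comm ‖z.2‖]
  gcongr

theorem hasFDerivAt_flatTerm {s : ℝ} {Y : ℝ → ℂ} {z : ℝ × ℝ} (hY : GevreyAt s Y z.1)
    (p q j : ℕ) :
    HasFDerivAt (flatTerm Y p q j)
      (ofPartials (flatTerm Y (p + 1) q j z, flatTerm Y p (q + 1) j z)) z := by
  obtain ⟨C, K, -, -, h⟩ := hY
  have h0 : HasFDerivAt (fun z : ℝ × ℝ => z.1) (ContinuousLinearMap.fst ℝ ℝ ℝ) z :=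
    hasFDerivAt_fst
  have h0' : HasFDerivAt (fun z : ℝ × ℝ => z.2) (ContinuousLinearMap.snd ℝ ℝ ℝ) z :=
    hasFDerivAt_snd
  have h1 : HasFDerivAt (fun z : ℝ × ℝ => iteratedDeriv (j + p) Y z.1) _ z :=
    (h.self_of_nhds (j + p)).1.hasFDerivAt.comp z h0
  have h2 : HasFDerivAt (fun z : ℝ × ℝ => (dividedPow (2 * j + 1) q z.2 : ℂ)) _ z :=
    HasFDerivAt.comp (g := fun x : ℝ => (dividedPow (2 * j + 1) q x : ℂ)) z
      (hasDerivAt_dividedPow (2 * j + 1) q z.2).ofReal_comp.hasFDerivAt h0'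
  refine ((h2.const_mul ((-Complex.I) ^ j)).mul h1).congr_fderiv ?_
  ext <;> simp [ofPartials_apply, flatTerm, ← iteratedDeriv_succ, add_assoc]
  all_goals ring

/-- The flatness expansion of `Y`, differentiated `p` times in time and `q` times in space. -/
noncomputable def flatSeries (Y : ℝ → ℂ) (p q : ℕ) (z : ℝ × ℝ) : ℂ := ∑' j, flatTerm Y p q j z

theorem summable_flatTerm {s : ℝ} (hs : s ∈ Ioo (1 : ℝ) 2) {Y : ℝ → ℂ} {z : ℝ × ℝ}
    (hY : GevreyAt s Y z.1) (p q : ℕ) : Summable fun j => flatTerm Y p q j z := by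
  obtain ⟨C, L, -, -, h⟩ := exists_norm_flatTerm_le hs (isCompact_singleton (x := z.1))
    (by simpa using hY) (abs_nonneg z.2)
  exact Summable.of_norm_bounded (summable_geometric_two.mul_left _)
    fun j => h p q j z.1 rfl z.2 ⟨neg_abs_le _, le_abs_self _⟩

theorem exists_norm_flatSeries_le {s : ℝ} (hs : s ∈ Ioo (1 : ℝ) 2) {Y : ℝ → ℂ} {S : Set ℝ}
    (hS : IsCompact S) (hY : ∀ t ∈ S, GevreyAt s Y t) {B : ℝ} (hB : 0 ≤ B) :
    ∃ C L : ℝ, 0 < C ∧ 1 ≤ L ∧ ∀ p q : ℕ, ∀ t ∈ S, ∀ x ∈ Icc (-B) B,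
      ‖flatSeries Y p q (t, x)‖ ≤ C * (p.factorial : ℝ) ^ s * L ^ p *
        ((q.factorial : ℝ) ^ (s / 2) * L ^ q) := by
  obtain ⟨C, L, hC, hL, h⟩ := exists_norm_flatTerm_le hs hS hY hB
  refine ⟨C * 2, L, by positivity, hL, fun p q t ht x hx => ?_⟩
  refine (tsum_of_norm_bounded (hasSum_geometric_two.mul_left _)
    fun j => h p q j t ht x hx).trans_eq ?_
  ring

theorem hasFDerivAt_flatSeries {s : ℝ} (hs : s ∈ Ioo (1 : ℝ) 2) {Y : ℝ → ℂ}
    (hY : ∀ t, 0 < t → GevreyAt s Y t) {z : ℝ × ℝ} (hz : 0 < z.1) (p q : ℕ) :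
    HasFDerivAt (flatSeries Y p q)
      (ofPartials (flatSeries Y (p + 1) q z, flatSeries Y p (q + 1) z)) z := by
  obtain ⟨C, L, -, -, h⟩ := exists_norm_flatTerm_le hs (isCompact_Icc (a := z.1 / 2) (b := z.1 + 1))
    (fun t ht => hY t (by linarith [ht.1])) (B := |z.2| + 1) (by positivity)
  set V : Set (ℝ × ℝ) := Ioo (z.1 / 2) (z.1 + 1) ×ˢ Ioo (-(|z.2| + 1)) (|z.2| + 1) with hV
  have hVo : IsOpen V := isOpen_Ioo.prod isOpen_Ioo
  have hVc : IsPreconnected V := isPreconnected_Ioo.prod isPreconnected_Ioo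
  have hzV : z ∈ V := by
    refine ⟨⟨by linarith, by linarith⟩, ?_, ?_⟩
    · linarith [neg_abs_le z.2]
    · linarith [le_abs_self z.2]
  have hd : ∀ j, ∀ w ∈ V, HasFDerivAt (flatTerm Y p q j)
      (ofPartials (flatTerm Y (p + 1) q j w, flatTerm Y p (q + 1) j w)) w := fun j w hw =>
    hasFDerivAt_flatTerm (hY _ (by linarith [hw.1.1])) p q j
  have hb : ∀ j, ∀ w ∈ V,
      ‖ofPartials (flatTerm Y (p + 1) q j w, flatTerm Y p (q + 1) j w)‖ ≤ _ := fun j w hw =>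
    (norm_ofPartials_le _ _).trans (add_le_add
      (h (p + 1) q j w.1 (Ioo_subset_Icc_self hw.1) w.2 (Ioo_subset_Icc_self hw.2))
      (h p (q + 1) j w.1 (Ioo_subset_Icc_self hw.1) w.2 (Ioo_subset_Icc_self hw.2)))
  have hmain := hasFDerivAt_tsum_of_isPreconnected
    ((summable_geometric_two.mul_left _).add (summable_geometric_two.mul_left _)) hVo hVc hd hb hzV
    (summable_flatTerm hs (hY _ hz) p q) hzV
  refine hmain.congr_fderiv ?_
  exact (ofPartials.hasSum ((summable_flatTerm hs (hY _ hz) (p + 1) q).hasSum.prodMk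
    (summable_flatTerm hs (hY _ hz) p (q + 1)).hasSum)).tsum_eq

theorem contDiffOn_flatSeries {s : ℝ} (hs : s ∈ Ioo (1 : ℝ) 2) {Y : ℝ → ℂ}
    (hY : ∀ t, 0 < t → GevreyAt s Y t) (p q : ℕ) :
    ContDiffOn ℝ ∞ (flatSeries Y p q) (Ioi 0 ×ˢ univ) := by
  refine contDiffOn_infty.2 fun n => ?_
  have ho : IsOpen (Ioi (0 : ℝ) ×ˢ (univ : Set ℝ)) := isOpen_Ioi.prod isOpen_univ
  induction n generalizing p q with
  | zero =>
    exact contDiffOn_zero.2 fun z hz =>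
      (hasFDerivAt_flatSeries hs hY hz.1 p q).continuousAt.continuousWithinAt
  | succ n ih =>
    rw [Nat.cast_succ, contDiffOn_succ_iff_fderiv_of_isOpen ho]
    refine ⟨fun z hz =>
      (hasFDerivAt_flatSeries hs hY hz.1 p q).differentiableAt.differentiableWithinAt, by simp, ?_⟩
    exact (ofPartials.contDiff.comp_contDiffOn ((ih (p + 1) q).prodMk (ih p (q + 1)))).congr
      fun z hz => (hasFDerivAt_flatSeries hs hY hz.1 p q).fderiv

theorem hasDerivAt_flatSeries_fst {s : ℝ} (hs : s ∈ Ioo (1 : ℝ) 2) {Y : ℝ → ℂ}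
    (hY : ∀ t, 0 < t → GevreyAt s Y t) (p q : ℕ) {t : ℝ} (ht : 0 < t) (x : ℝ) :
    HasDerivAt (fun t => flatSeries Y p q (t, x)) (flatSeries Y (p + 1) q (t, x)) t := by
  have h := (hasFDerivAt_flatSeries hs hY (z := (t, x)) ht p q).comp_hasDerivAt t
    ((hasDerivAt_id t).prodMk (hasDerivAt_const t x))
  refine h.congr_deriv ?_
  simp [ofPartials_apply]

theorem hasDerivAt_flatSeries_snd {s : ℝ} (hs : s ∈ Ioo (1 : ℝ) 2) {Y : ℝ → ℂ}
    (hY : ∀ t, 0 < t → GevreyAt s Y t) (p q : ℕ) {t : ℝ} (ht : 0 < t) (x : ℝ) :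
    HasDerivAt (fun x => flatSeries Y p q (t, x)) (flatSeries Y p (q + 1) (t, x)) x := by
  have h := (hasFDerivAt_flatSeries hs hY (z := (t, x)) ht p q).comp_hasDerivAt x
    ((hasDerivAt_const x t).prodMk (hasDerivAt_id x))
  refine h.congr_deriv ?_
  simp [ofPartials_apply]

theorem iteratedDeriv_flatSeries_snd {s : ℝ} (hs : s ∈ Ioo (1 : ℝ) 2) {Y : ℝ → ℂ}
    (hY : ∀ t, 0 < t → GevreyAt s Y t) (q : ℕ) {t : ℝ} (ht : 0 < t) :
    iteratedDeriv q (fun x => flatSeries Y 0 0 (t, x)) = fun x => flatSeries Y 0 q (t, x) := by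
  induction q with
  | zero => simp
  | succ q ih =>
    rw [iteratedDeriv_succ, ih]
    ext x
    exact (hasDerivAt_flatSeries_snd hs hY 0 q ht x).deriv

theorem iteratedDeriv_flatSeries_fst {s : ℝ} (hs : s ∈ Ioo (1 : ℝ) 2) {Y : ℝ → ℂ}
    (hY : ∀ t, 0 < t → GevreyAt s Y t) (p q : ℕ) (x : ℝ) :
    EqOn (iteratedDeriv p (fun t => flatSeries Y 0 q (t, x))) (fun t => flatSeries Y p q (t, x))
      (Ioi 0) := by
  induction p with
  | zero => intro t _; simp
  | succ p ih =>
    intro t ht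
    rw [iteratedDeriv_succ, (ih.eventuallyEq_of_mem (Ioi_mem_nhds ht)).deriv_eq]
    exact (hasDerivAt_flatSeries_fst hs hY p q ht x).deriv

theorem flatSeries_add_two {s : ℝ} (hs : s ∈ Ioo (1 : ℝ) 2) {Y : ℝ → ℂ} {z : ℝ × ℝ}
    (hY : GevreyAt s Y z.1) (p q : ℕ) :
    flatSeries Y p (q + 2) z =
      -Complex.I * flatSeries Y (p + 1) q z + flatTerm Y p (q + 2) 0 z := by
  have h := (summable_flatTerm hs hY p (q + 2)).tsum_eq_zero_add
  rw [flatSeries, h, add_comm, flatSeries, ← tsum_mul_left]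
  congr 1
  refine tsum_congr fun j => ?_
  rw [flatTerm, flatTerm, show 2 * (j + 1) + 1 = 2 * j + 1 + 2 by ring, dividedPow_add_two,
    show j + 1 + p = j + (p + 1) by ring]
  ring

theorem schrodinger_flatSeries {s : ℝ} (hs : s ∈ Ioo (1 : ℝ) 2) {Y : ℝ → ℂ} {z : ℝ × ℝ}
    (hY : GevreyAt s Y z.1) :
    Complex.I * flatSeries Y 1 0 z + flatSeries Y 0 2 z = 0 := by
  rw [flatSeries_add_two hs hY 0 0]
  simp [flatTerm, dividedPow]

theorem gevreyAt_boundaryFlux {s : ℝ} (hs : 1 ≤ s) {θ₀ : ℝ → ℂ}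
    (hθ₀ : MemLp θ₀ 2 (volume.restrict (Ioo (0 : ℝ) 1))) {t : ℝ} (ht : 0 < t) :
    GevreyAt s (fun t : ℝ => boundaryFlux θ₀ t) t :=
  gevreyAt_of_analyticAt hs (analyticAt_boundaryFlux hθ₀ (by simpa using ht))
    (Eventually.of_forall fun _ => rfl)

theorem gevreyAt_flatY {s M T τ : ℝ} (hs : 1 < s) (hM : 0 < M) {θ₀ : ℝ → ℂ}
    (hθ₀ : MemLp θ₀ 2 (volume.restrict (Ioo (0 : ℝ) 1))) {t : ℝ} (ht : 0 < t) :
    GevreyAt s (flatY θ₀ s M T τ) t := by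
  have h1 : GevreyAt s (fun t : ℝ => (phiStep s M ((T - τ)⁻¹ * t + -τ / (T - τ)) : ℂ)) t :=
    GevreyAt.comp_affine (gevreyAt_phiStep hs hM _)
  refine (h1.mul hs.le (gevreyAt_boundaryFlux hs.le hθ₀ ht)).congr ?_
  filter_upwards [Ioi_mem_nhds ht] with r hr
  rw [flatY, deriv_thetaMinus_zero hθ₀ hr]
  congr 3
  ring

theorem iteratedDeriv_boundaryFlux {θ₀ : ℝ → ℂ}
    (hθ₀ : MemLp θ₀ 2 (volume.restrict (Ioo (0 : ℝ) 1))) {t : ℝ} (ht : 0 < t) (j : ℕ) :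
    iteratedDeriv j (fun t : ℝ => boundaryFlux θ₀ t) t = iteratedDeriv j (boundaryFlux θ₀) t :=
  (iteratedDeriv_eq_of_analyticAt isOpen_Ioi
    (fun y (hy : y ∈ Ioi (0 : ℝ)) => analyticAt_boundaryFlux hθ₀ (by simpa using hy))
    (fun _ _ => rfl) j t ht).1

theorem GevreyAt.iteratedDeriv_eq_of_mem_closure {s t : ℝ} {f g : ℝ → ℂ} {S : Set ℝ}
    (hf : GevreyAt s f t) (hg : GevreyAt s g t) (hS : IsOpen S) (ht : t ∈ closure S)
    (h : EqOn f g S) (j : ℕ) : iteratedDeriv j f t = iteratedDeriv j g t := by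
  have hS' : EqOn (iteratedDeriv j f) (iteratedDeriv j g) S := by
    induction j with
    | zero => simpa using h
    | succ j ih =>
      intro x hx
      rw [iteratedDeriv_succ, iteratedDeriv_succ,
        (ih.eventuallyEq_of_mem (hS.mem_nhds hx)).deriv_eq]
  obtain ⟨_, _, -, -, hf⟩ := hf
  obtain ⟨_, _, -, -, hg⟩ := hg
  have := mem_closure_iff_nhdsWithin_neBot.1 ht
  have h1 := (hf.self_of_nhds j).1.continuousAt.continuousWithinAt (s := S)
  have h2 := (hg.self_of_nhds j).1.continuousAt.continuousWithinAt (s := S)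
  exact tendsto_nhds_unique_of_eventuallyEq h1.tendsto h2.tendsto
    (hS'.eventuallyEq_of_mem self_mem_nhdsWithin)

theorem iteratedDeriv_flatY_of_le {s M T τ : ℝ} (hs : 1 < s) (hM : 0 < M) (hτ : τ ∈ Ioo 0 T)
    {θ₀ : ℝ → ℂ} (hθ₀ : MemLp θ₀ 2 (volume.restrict (Ioo (0 : ℝ) 1))) {t : ℝ}
    (ht : t ∈ Ioc 0 τ) (j : ℕ) :
    iteratedDeriv j (flatY θ₀ s M T τ) t = iteratedDeriv j (boundaryFlux θ₀) t := by
  rw [← iteratedDeriv_boundaryFlux hθ₀ ht.1]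
  refine (gevreyAt_flatY hs hM hθ₀ ht.1).iteratedDeriv_eq_of_mem_closure
    (gevreyAt_boundaryFlux hs.le hθ₀ ht.1) (isOpen_Ioo (a := 0) (b := τ)) ?_ ?_ j
  · rw [closure_Ioo hτ.1.ne]; exact Ioc_subset_Icc_self ht
  · intro r hr
    have : (r - τ) / (T - τ) ≤ 0 :=
      div_nonpos_of_nonpos_of_nonneg (by linarith [hr.2]) (by linarith [hτ.2])
    simp only [flatY, deriv_thetaMinus_zero hθ₀ hr.1, phiStep, if_pos this, ofReal_one, one_mul]

theorem iteratedDeriv_flatY_final {s M T τ : ℝ} (hs : 1 < s) (hM : 0 < M) (hτ : τ ∈ Ioo 0 T)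
    {θ₀ : ℝ → ℂ} (hθ₀ : MemLp θ₀ 2 (volume.restrict (Ioo (0 : ℝ) 1))) (j : ℕ) :
    iteratedDeriv j (flatY θ₀ s M T τ) T = 0 := by
  have hT : 0 < T := hτ.1.trans hτ.2
  rw [(gevreyAt_flatY hs hM hθ₀ hT).iteratedDeriv_eq_of_mem_closure
    (gevreyAt_const s 0 T (by linarith)) (isOpen_Ioi (a := T))
    (by rw [closure_Ioi]; exact self_mem_Ici) ?_ j]
  · simp
  · intro r hr
    have hr : T < r := hr
    have h1 : 1 ≤ (r - τ) / (T - τ) := by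
      rw [one_le_div (by linarith [hτ.2])]; linarith
    simp only [flatY, phiStep, if_pos h1, if_neg (show ¬ (r - τ) / (T - τ) ≤ 0 by linarith),
      ofReal_zero, zero_mul]

theorem trajTheta_eq_flatSeries {s M T τ : ℝ} (hs : 1 < s) (hM : 0 < M) (hτ : τ ∈ Ioo 0 T)
    {θ₀ : ℝ → ℂ} (hθ₀ : MemLp θ₀ 2 (volume.restrict (Ioo (0 : ℝ) 1))) {t : ℝ} (ht : 0 < t)
    (x : ℝ) : trajTheta θ₀ s M T τ t x = flatSeries (flatY θ₀ s M T τ) 0 0 (t, x) := by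
  have h : ∀ j, flatTerm (flatY θ₀ s M T τ) 0 0 j (t, x) =
      (-Complex.I) ^ j * (x : ℂ) ^ (2 * j + 1) / ((2 * j + 1).factorial : ℂ) *
        iteratedDeriv j (flatY θ₀ s M T τ) t := by
    intro j
    simp only [flatTerm, dividedPow, zero_le, if_true, tsub_zero, add_zero]
    push_cast
    ring
  rw [trajTheta, if_neg ht.ne', flatSeries, tsum_congr h]
  split_ifs with hτt
  · simp only [iteratedDeriv_flatY_of_le hs hM hτ hθ₀ ⟨ht, hτt⟩]
    exact (hasSum_thetaMinus hθ₀ ht x).tsum_eq.symm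
  · rfl

theorem trajTheta_final {s M T τ : ℝ} (hs : 1 < s) (hM : 0 < M) (hτ : τ ∈ Ioo 0 T)
    {θ₀ : ℝ → ℂ} (hθ₀ : MemLp θ₀ 2 (volume.restrict (Ioo (0 : ℝ) 1))) (x : ℝ) :
    trajTheta θ₀ s M T τ T x = 0 := by
  rw [trajTheta_eq_flatSeries hs hM hτ hθ₀ (hτ.1.trans hτ.2)]
  simp [flatSeries, flatTerm, iteratedDeriv_flatY_final hs hM hτ hθ₀]

theorem trajTheta_zero_right {s M T τ : ℝ} (hs : 1 < s) (hM : 0 < M) (hτ : τ ∈ Ioo 0 T)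
    {θ₀ : ℝ → ℂ} (hθ₀ : MemLp θ₀ 2 (volume.restrict (Ioo (0 : ℝ) 1))) {t : ℝ} (ht : 0 < t) :
    trajTheta θ₀ s M T τ t 0 = 0 := by
  rw [trajTheta_eq_flatSeries hs hM hτ hθ₀ ht]
  simp [flatSeries, flatTerm, dividedPow]

theorem schrodinger_trajTheta {s M T τ : ℝ} (hs : s ∈ Ioo (1 : ℝ) 2) (hM : 0 < M)
    (hτ : τ ∈ Ioo 0 T) {θ₀ : ℝ → ℂ} (hθ₀ : MemLp θ₀ 2 (volume.restrict (Ioo (0 : ℝ) 1)))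
    {t : ℝ} (ht : 0 < t) (x : ℝ) :
    Complex.I * deriv (fun t' => trajTheta θ₀ s M T τ t' x) t
        + iteratedDeriv 2 (fun x' => trajTheta θ₀ s M T τ t x') x = 0 := by
  have hY : ∀ r, 0 < r → GevreyAt s (flatY θ₀ s M T τ) r := fun r hr =>
    gevreyAt_flatY hs.1 hM hθ₀ hr
  have h1 : (fun t' => trajTheta θ₀ s M T τ t' x) =ᶠ[𝓝 t]
      fun t' => flatSeries (flatY θ₀ s M T τ) 0 0 (t', x) := by
    filter_upwards [Ioi_mem_nhds ht] with r hr
    exact trajTheta_eq_flatSeries hs.1 hM hτ hθ₀ hr x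
  rw [h1.deriv_eq, (hasDerivAt_flatSeries_fst hs hY 0 0 ht x).deriv]
  simp only [trajTheta_eq_flatSeries hs.1 hM hτ hθ₀ ht, iteratedDeriv_flatSeries_snd hs hY 2 ht]
  exact schrodinger_flatSeries hs (hY t ht)

theorem contDiffOn_trajTheta {s M T τ : ℝ} (hs : s ∈ Ioo (1 : ℝ) 2) (hM : 0 < M)
    (hτ : τ ∈ Ioo 0 T) {θ₀ : ℝ → ℂ} (hθ₀ : MemLp θ₀ 2 (volume.restrict (Ioo (0 : ℝ) 1))) :
    ContDiffOn ℝ ∞ (fun p : ℝ × ℝ => trajTheta θ₀ s M T τ p.1 p.2) (Ioi 0 ×ˢ univ) :=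
  (contDiffOn_flatSeries hs (fun _ hr => gevreyAt_flatY hs.1 hM hθ₀ hr) 0 0).congr
    fun p hp => trajTheta_eq_flatSeries hs.1 hM hτ hθ₀ hp.1 p.2

theorem exists_gevrey_bound_trajTheta {s M T τ : ℝ} (hs : s ∈ Ioo (1 : ℝ) 2) (hM : 0 < M)
    (hτ : τ ∈ Ioo 0 T) {θ₀ : ℝ → ℂ} (hθ₀ : MemLp θ₀ 2 (volume.restrict (Ioo (0 : ℝ) 1)))
    {ε : ℝ} (hε : 0 < ε) :
    ∃ C R₁ R₂ : ℝ, 0 < C ∧ 0 < R₁ ∧ 0 < R₂ ∧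
      ∀ p₁ p₂ : ℕ, ∀ t ∈ Icc ε T, ∀ x ∈ Icc (0 : ℝ) 1,
        ‖iteratedDeriv p₁ (fun t' => iteratedDeriv p₂ (fun x' => trajTheta θ₀ s M T τ t' x') x) t‖
          ≤ C * (p₁.factorial : ℝ) ^ s * (p₂.factorial : ℝ) ^ (s / 2) / (R₁ ^ p₁ * R₂ ^ p₂) := by
  have hY : ∀ r, 0 < r → GevreyAt s (flatY θ₀ s M T τ) r := fun r hr =>
    gevreyAt_flatY hs.1 hM hθ₀ hr
  obtain ⟨C, L, hC, hL, h⟩ := exists_norm_flatSeries_le hs (isCompact_Icc (a := ε) (b := T))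
    (fun t ht => hY t (hε.trans_le ht.1)) zero_le_one
  have hL0 : 0 < L := by linarith
  refine ⟨C, L⁻¹, L⁻¹, hC, by positivity, by positivity, fun p q t ht x hx => ?_⟩
  have ht0 : 0 < t := hε.trans_le ht.1
  have h1 : (fun t' => iteratedDeriv q (fun x' => trajTheta θ₀ s M T τ t' x') x) =ᶠ[𝓝 t]
      fun t' => flatSeries (flatY θ₀ s M T τ) 0 q (t', x) := by
    filter_upwards [Ioi_mem_nhds ht0] with r hr
    have hr : 0 < r := hr
    simp only [trajTheta_eq_flatSeries hs.1 hM hτ hθ₀ hr, iteratedDeriv_flatSeries_snd hs hY q hr]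
  rw [h1.iteratedDeriv_eq, iteratedDeriv_flatSeries_fst hs hY p q x ht0]
  refine (h p q t ht x ⟨by linarith [hx.1], hx.2⟩).trans_eq ?_
  rw [inv_pow, inv_pow, ← mul_inv, div_inv_eq_mul]
  ring

theorem eLpNorm_restrict_Ioo_le {g : ℝ → ℂ} {ε : ℝ} (h : ∀ x ∈ Ioo (0 : ℝ) 1, ‖g x‖ ≤ ε) :
    eLpNorm g 2 (volume.restrict (Ioo (0 : ℝ) 1)) ≤ ENNReal.ofReal ε := by
  refine (eLpNorm_le_of_ae_bound (C := ε) ?_).trans ?_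
  · filter_upwards [ae_restrict_mem measurableSet_Ioo] with x hx using h x hx
  · simp

theorem tendsto_eLpNorm_restrict_Ioo {l : Filter ℝ} {g : ℝ → ℝ → ℂ}
    (h : ∀ ε > 0, ∀ᶠ t in l, ∀ x ∈ Ioo (0 : ℝ) 1, ‖g t x‖ ≤ ε) :
    Tendsto (fun t => eLpNorm (g t) 2 (volume.restrict (Ioo (0 : ℝ) 1))) l (𝓝 0) := by
  rw [ENNReal.tendsto_nhds_zero]
  intro ε hε
  rcases eq_or_ne ε ⊤ with rfl | hε'
  · simp
  filter_upwards [h ε.toReal (ENNReal.toReal_pos hε.ne' hε')] with t ht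
  exact (eLpNorm_restrict_Ioo_le ht).trans_eq (ENNReal.ofReal_toReal hε')

theorem tendsto_eLpNorm_trajTheta_of_pos {s M T τ : ℝ} (hs : s ∈ Ioo (1 : ℝ) 2) (hM : 0 < M)
    (hτ : τ ∈ Ioo 0 T) {θ₀ : ℝ → ℂ} (hθ₀ : MemLp θ₀ 2 (volume.restrict (Ioo (0 : ℝ) 1)))
    {t₀ : ℝ} (ht₀ : 0 < t₀) :
    Tendsto (fun t => eLpNorm (fun x => trajTheta θ₀ s M T τ t x - trajTheta θ₀ s M T τ t₀ x) 2
      (volume.restrict (Ioo (0 : ℝ) 1))) (𝓝 t₀) (𝓝 0) := by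
  refine tendsto_eLpNorm_restrict_Ioo fun ε hε => ?_
  have hc := (contDiffOn_trajTheta (s := s) hs hM hτ hθ₀).continuousOn
  have h : ∀ x : ℝ, ContinuousAt (fun p : ℝ × ℝ => trajTheta θ₀ s M T τ p.1 p.2) (t₀, x) :=
    fun x => hc.continuousAt ((isOpen_Ioi.prod isOpen_univ).mem_nhds ⟨ht₀, mem_univ x⟩)
  have h2 : ∀ x ∈ Icc (0 : ℝ) 1, ∀ᶠ p : ℝ × ℝ in 𝓝 (t₀, x),
      ‖trajTheta θ₀ s M T τ p.1 p.2 - trajTheta θ₀ s M T τ t₀ p.2‖ ≤ ε := by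
    intro x _
    have h3 : ContinuousAt (fun p : ℝ × ℝ => trajTheta θ₀ s M T τ t₀ p.2) (t₀, x) :=
      ContinuousAt.comp (g := fun p : ℝ × ℝ => trajTheta θ₀ s M T τ p.1 p.2)
        (f := fun p : ℝ × ℝ => (t₀, p.2)) (h x) (by fun_prop)
    exact ((h x).sub h3).norm.eventually_le_const (by simpa using hε)
  filter_upwards [isCompact_Icc.eventually_forall_of_forall_eventually
    (P := fun t x => ‖trajTheta θ₀ s M T τ t x - trajTheta θ₀ s M T τ t₀ x‖ ≤ ε) h2] with t ht x hx
  exact ht x (Ioo_subset_Icc_self hx)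

/-- Smooth functions vanishing outside `(-2, 2)`. -/
def IsTestFun (g : ℝ → ℂ) : Prop := ContDiff ℝ ∞ g ∧ ∀ y ∉ Ioo (-2 : ℝ) 2, g y = 0

theorem IsTestFun.hasCompactSupport {g : ℝ → ℂ} (hg : IsTestFun g) : HasCompactSupport g :=
  HasCompactSupport.intro (isCompact_Icc (a := (-2 : ℝ)) (b := 2))
    fun y hy => hg.2 y fun h => hy (Ioo_subset_Icc_self h)

theorem IsTestFun.sub {f g : ℝ → ℂ} (hf : IsTestFun f) (hg : IsTestFun g) : IsTestFun (f - g) :=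
  ⟨hf.1.sub hg.1, fun y hy => by simp [hf.2 y hy, hg.2 y hy]⟩

theorem IsTestFun.memLp {g : ℝ → ℂ} (hg : IsTestFun g) : MemLp g 2 volume :=
  hg.1.continuous.memLp_of_hasCompactSupport hg.hasCompactSupport

theorem integrableOn_of_memLp_two {g : ℝ → ℂ} (hg : MemLp g 2 volume) :
    IntegrableOn g (Ioo (-2) 2) := (hg.restrict _).integrable (by norm_num)

theorem integrable_translates {f : ℝ → ℂ} (hf : IntegrableOn f (Ioo (-2) 2)) {G : ℂ × ℂ → ℂ}
    (hG : ContinuousOn G rightHalf) {p : ℂ × ℂ} (hp : p ∈ rightHalf) :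
    Integrable (fun y : ℝ => f y • G (p - (0, (y : ℂ)))) (volume.restrict (Ioo (-2 : ℝ) 2)) := by
  obtain ⟨r, hr, B, hB⟩ := exists_bound_translates hG hp
  refine (hf.norm.mul_const B).mono' (aestronglyMeasurable_translates hf hG hp) ?_
  filter_upwards [ae_restrict_mem measurableSet_Ioo] with y hy
  rw [norm_smul]
  exact mul_le_mul_of_nonneg_left
    (hB p (Metric.mem_closedBall_self hr.le) y (Ioo_subset_Icc_self hy)).2 (norm_nonneg _)

theorem superpose_sub {f g : ℝ → ℂ} (hf : IntegrableOn f (Ioo (-2) 2))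
    (hg : IntegrableOn g (Ioo (-2) 2)) {G : ℂ × ℂ → ℂ} (hG : ContinuousOn G rightHalf)
    {p : ℂ × ℂ} (hp : p ∈ rightHalf) :
    superpose (f - g) G p = superpose f G p - superpose g G p := by
  rw [superpose, superpose, superpose,
    ← integral_sub (integrable_translates hf hG hp) (integrable_translates hg hG hp)]
  simp only [Pi.sub_apply, sub_smul]

/-- The free Schrödinger evolution at time `t` of the restriction of `f` to `(-2, 2)`. -/
noncomputable def freeEvolution (f : ℝ → ℂ) (t x : ℝ) : ℂ :=
  superpose f schroKernel ((t : ℂ), (x : ℂ))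

theorem freeEvolution_sub {f g : ℝ → ℂ} (hf : MemLp f 2 volume) (hg : MemLp g 2 volume) {t : ℝ}
    (ht : 0 < t) (x : ℝ) :
    freeEvolution (f - g) t x = freeEvolution f t x - freeEvolution g t x :=
  superpose_sub (integrableOn_of_memLp_two hf) (integrableOn_of_memLp_two hg)
    contDiffOn_schroKernel.continuousOn (by simpa [rightHalf] using ht)

theorem continuous_freeEvolution {f : ℝ → ℂ} (hf : MemLp f 2 volume) {t : ℝ} (ht : 0 < t) :
    Continuous (freeEvolution f t) := by
  have h := (isSchrodingerSol_schroKernel.superpose (integrableOn_of_memLp_two hf)).1.continuousOn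
  exact h.comp_continuous (f := fun x : ℝ => ((t : ℂ), (x : ℂ))) (by fun_prop)
    fun x => by simpa [rightHalf] using ht

theorem superpose_of_isTestFun {g : ℝ → ℂ} (hg : IsTestFun g) (G : ℂ × ℂ → ℂ) (t x : ℂ) :
    superpose g G (t, x) = ∫ y : ℝ, g y * G (t, x - y) := by
  rw [superpose]
  simp only [Prod.mk_sub_mk, sub_zero, smul_eq_mul]
  refine setIntegral_eq_integral_of_forall_compl_eq_zero fun y hy => ?_
  rw [hg.2 y hy, zero_mul]

theorem norm_schroKernel_real {t : ℝ} (ht : 0 < t) (x : ℝ) :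
    ‖schroKernel ((t : ℂ), (x : ℂ))‖ = (4 * Real.pi * t) ^ (-(1 / 2 : ℝ)) := by
  have h1 : Complex.I * (x : ℂ) ^ 2 / (4 * (t : ℂ)) = ((x ^ 2 / (4 * t) : ℝ) : ℂ) * Complex.I := by
    push_cast; ring
  have h2 : ((1 : ℂ) / 2) = ((1 / 2 : ℝ) : ℂ) := by push_cast; rfl
  rw [schroKernel, norm_div, h1, Complex.norm_exp_ofReal_mul_I, h2, Complex.norm_cpow_real,
    Real.rpow_neg (by positivity), one_div]
  congr 2
  simp [abs_of_pos ht, abs_of_pos Real.pi_pos]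

theorem norm_freeEvolution_le {f : ℝ → ℂ} {t : ℝ} (ht : 0 < t) (x : ℝ) :
    ‖freeEvolution f t x‖ ≤ (4 * Real.pi * t) ^ (-(1 / 2 : ℝ)) * ∫ y in Ioo (-2 : ℝ) 2, ‖f y‖ := by
  rw [freeEvolution, superpose, ← integral_const_mul]
  refine (norm_integral_le_integral_norm _).trans_eq ?_
  refine integral_congr_ae (ae_of_all _ fun y => ?_)
  have := norm_schroKernel_real ht (x - y)
  push_cast at this
  simp only [Prod.mk_sub_mk, sub_zero, norm_smul, this, mul_comm]

theorem schroKernel_eq_fourier_gaussian {z : ℂ} (hz : z.im < 0) (x y : ℝ) :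
    schroKernel (z, (x : ℂ) - y) =
      𝓕 (fun ξ : ℝ => cexp (-π * (4 * π * Complex.I * z) * ξ ^ 2 +
        2 * π * (Complex.I * x) * ξ)) y := by
  have hb : 0 < (4 * (π : ℂ) * Complex.I * z).re := by
    have : (4 * (π : ℂ) * Complex.I * z).re = -(4 * π * z.im) := by
      simp [Complex.mul_re, Complex.mul_im]
    rw [this]
    nlinarith [Real.pi_pos]
  have hz0 : z ≠ 0 := by rintro rfl; simp at hz
  have hpi : (π : ℂ) ≠ 0 := by exact_mod_cast Real.pi_ne_zero
  rw [fourier_gaussian_pi' hb, schroKernel, div_eq_mul_one_div, mul_comm]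
  congr 2
  rw [← mul_assoc, Complex.I_mul_I]
  field_simp
  rw [Complex.I_sq]
  ring

theorem superpose_eq_integral_fourier_of_im_neg {g : ℝ → ℂ} (hg : IsTestFun g) {z : ℂ}
    (hz : z.im < 0) (x : ℝ) :
    superpose g schroKernel (z, (x : ℂ)) =
      ∫ ξ : ℝ, cexp (-π * (4 * π * Complex.I * z) * ξ ^ 2 +
        2 * π * (Complex.I * x) * ξ) * 𝓕 g ξ := by
  set f : ℝ → ℂ := fun ξ => cexp (-π * (4 * π * Complex.I * z) * ξ ^ 2 +
    2 * π * (Complex.I * x) * ξ) with hf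
  have hgi : Integrable g := hg.1.continuous.integrable_of_hasCompactSupport hg.hasCompactSupport
  have hfi : Integrable f := by
    have h : (-(π : ℂ) * (4 * π * Complex.I * z)).re < 0 := by
      have : (-(π : ℂ) * (4 * π * Complex.I * z)).re = 4 * π ^ 2 * z.im := by
        simp [Complex.mul_re, Complex.mul_im]; ring
      rw [this]
      have := Real.pi_pos
      exact mul_neg_of_pos_of_neg (by positivity) hz
    simpa only [hf, add_zero] using integrable_cexp_quadratic' h (2 * π * (Complex.I * x)) 0
  rw [superpose_of_isTestFun hg]
  have h := VectorFourier.integral_fourierIntegral_smul_eq_flip (μ := volume) (ν := volume)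
    (L := innerₗ ℝ) Real.continuous_fourierChar continuous_inner hfi hgi
  simp only [flip_innerₗ, smul_eq_mul] at h
  refine Eq.trans ?_ h
  refine integral_congr_ae (ae_of_all _ fun y => ?_)
  change g y * schroKernel (z, (x : ℂ) - y) = _
  rw [schroKernel_eq_fourier_gaussian hz, mul_comm]
  rfl

theorem IsTestFun.integrable_fourier {g : ℝ → ℂ} (hg : IsTestFun g) : Integrable (𝓕 g) :=
  (𝓕 (hg.hasCompactSupport.toSchwartzMap hg.1)).integrable

theorem IsTestFun.integrable {g : ℝ → ℂ} (hg : IsTestFun g) : Integrable g :=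
  hg.1.continuous.integrable_of_hasCompactSupport hg.hasCompactSupport

theorem norm_cexp_schrodinger_symbol_le {z : ℂ} (hz : z.im ≤ 0) (x ξ : ℝ) :
    ‖cexp (-π * (4 * π * Complex.I * z) * ξ ^ 2 + 2 * π * (Complex.I * x) * ξ)‖ ≤ 1 := by
  rw [Complex.norm_exp, Real.exp_le_one_iff]
  have : (-π * (4 * π * Complex.I * z) * ξ ^ 2 + 2 * π * (Complex.I * x) * ξ : ℂ).re
      = 4 * π ^ 2 * ξ ^ 2 * z.im := by
    simp [Complex.mul_re, Complex.mul_im, ← Complex.ofReal_pow]; ring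
  rw [this]
  exact mul_nonpos_of_nonneg_of_nonpos (by positivity) hz

theorem freeEvolution_eq_integral_fourier {g : ℝ → ℂ} (hg : IsTestFun g) {t : ℝ} (ht : 0 < t)
    (x : ℝ) :
    freeEvolution g t x =
      ∫ ξ : ℝ, cexp (-π * (4 * π * Complex.I * t) * ξ ^ 2 +
        2 * π * (Complex.I * x) * ξ) * 𝓕 g ξ := by
  have hz : Tendsto (fun ε : ℝ => (t : ℂ) - ε * Complex.I) (𝓝[>] 0) (𝓝 (t : ℂ)) := by
    have : Continuous fun ε : ℝ => (t : ℂ) - ε * Complex.I := by fun_prop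
    simpa using (this.tendsto 0).mono_left nhdsWithin_le_nhds
  have hlhs : Tendsto (fun ε : ℝ => superpose g schroKernel ((t : ℂ) - ε * Complex.I, (x : ℂ)))
      (𝓝[>] 0) (𝓝 (freeEvolution g t x)) := by
    have hc := (isSchrodingerSol_schroKernel.superpose
      (integrableOn_of_memLp_two hg.memLp)).1.continuousOn.continuousAt
      (isOpen_rightHalf.mem_nhds (show ((t : ℂ), (x : ℂ)) ∈ rightHalf by
        simpa [rightHalf] using ht))
    exact hc.tendsto.comp (hz.prodMk_nhds tendsto_const_nhds)
  refine tendsto_nhds_unique hlhs ?_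
  have him : ∀ ε : ℝ, ((t : ℂ) - ε * Complex.I).im = -ε := fun ε => by simp
  have heq : (fun ε : ℝ => ∫ ξ : ℝ,
      cexp (-π * (4 * π * Complex.I * ((t : ℂ) - ε * Complex.I)) * ξ ^ 2
      + 2 * π * (Complex.I * x) * ξ) * 𝓕 g ξ) =ᶠ[𝓝[>] 0]
      fun ε : ℝ => superpose g schroKernel ((t : ℂ) - ε * Complex.I, (x : ℂ)) := by
    filter_upwards [self_mem_nhdsWithin] with ε hε
    exact (superpose_eq_integral_fourier_of_im_neg hg (by rw [him]; exact neg_neg_of_pos hε) x).symm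
  refine Tendsto.congr' heq ?_
  refine tendsto_integral_filter_of_dominated_convergence (fun ξ => ‖𝓕 g ξ‖) ?_ ?_
    hg.integrable_fourier.norm ?_
  · refine Eventually.of_forall fun ε => AEStronglyMeasurable.mul ?_
      hg.integrable_fourier.aestronglyMeasurable
    exact Continuous.aestronglyMeasurable (by fun_prop)
  · filter_upwards [self_mem_nhdsWithin] with ε hε
    refine ae_of_all _ fun ξ => ?_
    rw [norm_mul]
    refine mul_le_of_le_one_left (norm_nonneg _) (norm_cexp_schrodinger_symbol_le ?_ x ξ)
    rw [him]
    exact (neg_neg_of_pos hε).le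
  · refine ae_of_all _ fun ξ => Tendsto.mul_const _ ?_
    have : Continuous fun z : ℂ => cexp (-π * (4 * π * Complex.I * z) * ξ ^ 2
      + 2 * π * (Complex.I * x) * ξ) := by fun_prop
    exact (this.tendsto _).comp hz

theorem IsTestFun.eq_integral_fourier {g : ℝ → ℂ} (hg : IsTestFun g) (x : ℝ) :
    g x = ∫ ξ : ℝ, cexp (2 * π * (Complex.I * x) * ξ) * 𝓕 g ξ := by
  have h := congrFun (hg.1.continuous.fourierInv_fourier_eq hg.integrable hg.integrable_fourier) x
  rw [Real.fourierInv_eq'] at h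
  rw [← h]
  refine integral_congr_ae (ae_of_all _ fun ξ => ?_)
  simp only [smul_eq_mul]
  congr 2
  simp
  ring

theorem norm_freeEvolution_sub_le {g : ℝ → ℂ} (hg : IsTestFun g) {t : ℝ} (ht : 0 < t) (x : ℝ) :
    ‖freeEvolution g t x - g x‖ ≤
      ∫ ξ : ℝ, ‖cexp (-π * (4 * π * Complex.I * t) * ξ ^ 2) - 1‖ * ‖𝓕 g ξ‖ := by
  have h1 : Integrable fun ξ : ℝ =>
      cexp (-π * (4 * π * Complex.I * t) * ξ ^ 2 +
        2 * π * (Complex.I * x) * ξ) * 𝓕 g ξ := by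
    refine hg.integrable_fourier.bdd_mul (c := 1)
      (Continuous.aestronglyMeasurable (by fun_prop)) (ae_of_all _ fun ξ => ?_)
    exact norm_cexp_schrodinger_symbol_le (by simp) x ξ
  have h2 : Integrable fun ξ : ℝ => cexp (2 * π * (Complex.I * x) * ξ) * 𝓕 g ξ := by
    refine hg.integrable_fourier.bdd_mul (c := 1)
      (Continuous.aestronglyMeasurable (by fun_prop)) (ae_of_all _ fun ξ => ?_)
    simpa using norm_cexp_schrodinger_symbol_le (z := 0) (by simp) x ξ
  rw [freeEvolution_eq_integral_fourier hg ht, hg.eq_integral_fourier x, ← integral_sub h1 h2]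
  refine (norm_integral_le_integral_norm _).trans_eq (integral_congr_ae (ae_of_all _ fun ξ => ?_))
  have h3 : ‖cexp (2 * π * (Complex.I * x) * ξ)‖ = 1 := by
    have : (2 * π * (Complex.I * x) * ξ : ℂ) = ((2 * π * x * ξ : ℝ) : ℂ) * Complex.I := by
      push_cast; ring
    rw [this, Complex.norm_exp_ofReal_mul_I]
  simp only
  rw [Complex.exp_add, ← sub_mul, ← sub_one_mul, norm_mul, norm_mul, h3, mul_one]

theorem eventually_norm_freeEvolution_sub_le {g : ℝ → ℂ} (hg : IsTestFun g) {ε : ℝ} (hε : 0 < ε) :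
    ∀ᶠ t in 𝓝[>] (0 : ℝ), ∀ x, ‖freeEvolution g t x - g x‖ ≤ ε := by
  have h : Tendsto (fun t : ℝ => ∫ ξ : ℝ,
      ‖cexp (-π * (4 * π * Complex.I * t) * ξ ^ 2) - 1‖ * ‖𝓕 g ξ‖) (𝓝[>] 0)
      (𝓝 (∫ ξ : ℝ, (0 : ℝ))) := by
    refine tendsto_integral_filter_of_dominated_convergence (fun ξ => 2 * ‖𝓕 g ξ‖) ?_ ?_
      (hg.integrable_fourier.norm.const_mul 2) ?_
    · refine Eventually.of_forall fun t => AEStronglyMeasurable.mul ?_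
        hg.integrable_fourier.norm.aestronglyMeasurable
      exact Continuous.aestronglyMeasurable (by fun_prop)
    · refine Eventually.of_forall fun t => ae_of_all _ fun ξ => ?_
      rw [norm_mul, norm_norm, norm_norm]
      refine mul_le_mul_of_nonneg_right ((norm_sub_le _ _).trans ?_) (norm_nonneg _)
      have := norm_cexp_schrodinger_symbol_le (z := (t : ℂ)) (by simp) 0 ξ
      simp only [ofReal_zero, mul_zero, zero_mul, add_zero] at this
      rw [norm_one]
      linarith
    · refine ae_of_all _ fun ξ => ?_
      have : Continuous fun t : ℝ =>
          ‖cexp (-π * (4 * π * Complex.I * t) * ξ ^ 2) - 1‖ * ‖𝓕 g ξ‖ := by fun_prop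
      simpa using (this.tendsto 0).mono_left (nhdsWithin_le_nhds (s := Ioi 0))
  rw [integral_zero] at h
  filter_upwards [h.eventually (eventually_le_nhds hε), self_mem_nhdsWithin] with t h1 h2 x
  exact (norm_freeEvolution_sub_le hg h2 x).trans h1

theorem freeEvolution_eq_mul_fourier {g : ℝ → ℂ} (hg : IsTestFun g) {t : ℝ} (ht : 0 < t) (x : ℝ) :
    freeEvolution g t x = schroKernel ((t : ℂ), (x : ℂ)) *
      𝓕 (fun y : ℝ => cexp (Complex.I * y ^ 2 / (4 * t)) * g y) ((4 * π * t)⁻¹ * x) := by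
  rw [freeEvolution, superpose_of_isTestFun hg, Real.fourier_eq', ← integral_const_mul]
  refine integral_congr_ae (ae_of_all _ fun y => ?_)
  have ht' : (t : ℂ) ≠ 0 := by exact_mod_cast ht.ne'
  have hpi : (π : ℂ) ≠ 0 := by exact_mod_cast Real.pi_ne_zero
  have h : Complex.I * ((x : ℂ) - y) ^ 2 / (4 * t) = Complex.I * x ^ 2 / (4 * t) +
      (((-2 * π * inner ℝ y ((4 * π * t)⁻¹ * x) : ℝ) : ℂ) * Complex.I +
        Complex.I * y ^ 2 / (4 * t)) := by
    simp only [RCLike.inner_apply, conj_trivial]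
    push_cast
    field_simp
    ring
  simp only [schroKernel, smul_eq_mul]
  rw [h, Complex.exp_add, Complex.exp_add]
  ring

theorem eLpNorm_two_eq_ofReal {f : ℝ → ℂ} (hf : MemLp f 2 volume) :
    eLpNorm f 2 volume = ENNReal.ofReal ((∫ x, ‖f x‖ ^ 2) ^ (1 / 2 : ℝ)) := by
  rw [hf.eLpNorm_eq_integral_rpow_norm (by norm_num) (by norm_num)]
  norm_num

/-- The free evolution does not increase the `L²` norm of a test function. -/
theorem eLpNorm_freeEvolution_le_of_isTestFun {g : ℝ → ℂ} (hg : IsTestFun g) {t : ℝ} (ht : 0 < t) :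
    eLpNorm (freeEvolution g t) 2 volume ≤ eLpNorm g 2 volume := by
  set h : ℝ → ℂ := fun y => cexp (Complex.I * y ^ 2 / (4 * t)) * g y with h_def
  have hnorm : ∀ y, ‖h y‖ = ‖g y‖ := fun y => by
    have : Complex.I * (y : ℂ) ^ 2 / (4 * t) = ((y ^ 2 / (4 * t) : ℝ) : ℂ) * Complex.I := by
      push_cast; ring
    simp only [h_def]
    rw [norm_mul, this, Complex.norm_exp_ofReal_mul_I, one_mul]
  have hsupp : HasCompactSupport h := hg.hasCompactSupport.mul_left
  have hsmooth : ContDiff ℝ ∞ h := by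
    refine ContDiff.mul (ContDiff.cexp ?_) hg.1
    exact (contDiff_const.mul (Complex.ofRealCLM.contDiff.pow 2)).div_const _
  set H := hsupp.toSchwartzMap hsmooth with H_def
  have hH : ∀ ξ, 𝓕 H ξ = 𝓕 h ξ := fun ξ => rfl
  have hc : 0 < 4 * π * t := by positivity
  have hpt : ∀ x, ‖freeEvolution g t x‖ ^ 2 = (4 * π * t)⁻¹ * ‖𝓕 H ((4 * π * t)⁻¹ * x)‖ ^ 2 := by
    intro x
    rw [freeEvolution_eq_mul_fourier hg ht, norm_mul, mul_pow, norm_schroKernel_real ht,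
      ← Real.rpow_natCast, ← Real.rpow_mul hc.le, hH]
    rw [show (-(1 / 2) * (2 : ℕ) : ℝ) = -1 by norm_num, Real.rpow_neg_one]
  have hint : Integrable fun ξ => ‖𝓕 H ξ‖ ^ 2 :=
    (memLp_two_iff_integrable_sq_norm (𝓕 H).continuous.aestronglyMeasurable).1 ((𝓕 H).memLp 2)
  have hmem : MemLp (freeEvolution g t) 2 volume := by
    rw [memLp_two_iff_integrable_sq_norm
      (continuous_freeEvolution hg.memLp ht).aestronglyMeasurable]
    simp only [hpt]
    exact (hint.comp_mul_left' (inv_ne_zero hc.ne')).const_mul _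
  refine le_of_eq ?_
  rw [eLpNorm_two_eq_ofReal hmem, eLpNorm_two_eq_ofReal hg.memLp]
  congr 2
  simp only [hpt]
  rw [integral_const_mul, Measure.integral_comp_mul_left (fun ξ => ‖𝓕 H ξ‖ ^ 2),
    SchwartzMap.integral_norm_sq_fourier, inv_inv, abs_of_pos hc, smul_eq_mul,
    inv_mul_cancel_left₀ hc.ne']
  exact integral_congr_ae (ae_of_all _ fun y => congrArg (· ^ 2) (hnorm y))

/-- For fixed `t > 0`, the free evolution is bounded from `L²(-2, 2)` to `L²(0, 1)`. -/
theorem exists_eLpNorm_freeEvolution_le {t : ℝ} (ht : 0 < t) :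
    ∃ C : NNReal, ∀ f : ℝ → ℂ, MemLp f 2 volume →
      eLpNorm (freeEvolution f t) 2 (volume.restrict (Ioo (0 : ℝ) 1)) ≤
        C * eLpNorm f 2 volume := by
  set K : ℝ := (4 * π * t) ^ (-(1 / 2 : ℝ)) with hK
  have hK0 : 0 ≤ K := by positivity
  refine ⟨K.toNNReal * 2, fun f hf => ?_⟩
  have hfi := integrableOn_of_memLp_two hf
  refine (eLpNorm_restrict_Ioo_le fun x _ => norm_freeEvolution_le ht x).trans ?_
  rw [ENNReal.ofReal_mul hK0, ofReal_integral_norm_eq_lintegral_enorm hfi,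
    ← eLpNorm_one_eq_lintegral_enorm, ENNReal.coe_mul, mul_assoc]
  refine mul_le_mul' le_rfl ?_
  refine (eLpNorm_le_eLpNorm_mul_rpow_measure_univ (p := 1) (q := 2) (by norm_num)
    hfi.aestronglyMeasurable).trans ?_
  rw [mul_comm]
  refine mul_le_mul' ?_ (eLpNorm_mono_measure _ Measure.restrict_le_self)
  rw [Measure.restrict_apply_univ, Real.volume_Ioo, ENNReal.toReal_one, ENNReal.toReal_ofNat,
    show (2 - -2 : ℝ) = 2 ^ (2 : ℕ) by norm_num, ENNReal.ofReal_pow (by norm_num),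
    ← ENNReal.rpow_natCast, ← ENNReal.rpow_mul]
  norm_num

theorem exists_isTestFun_eLpNorm_sub_le {f : ℝ → ℂ} (hf : MemLp f 2 volume)
    (hf0 : ∀ x ∉ Ioo (-1 : ℝ) 1, f x = 0) {ε : ℝ} (hε : 0 < ε) :
    ∃ g, IsTestFun g ∧ eLpNorm (f - g) 2 volume ≤ ENNReal.ofReal ε := by
  obtain ⟨g, -, hg, hfg⟩ := hf.exist_eLpNorm_sub_le (by norm_num) (by norm_num) hε
  let χ : ContDiffBump (0 : ℝ) := ⟨1, 2, by norm_num, by norm_num⟩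
  refine ⟨fun x => (χ x : ℂ) * g x, ⟨?_, fun y hy => ?_⟩, (eLpNorm_mono fun x => ?_).trans hfg⟩
  · exact (Complex.ofRealCLM.contDiff.comp χ.contDiff).mul hg
  · have : χ y = 0 := χ.zero_of_le_dist (by
      by_contra h
      refine hy (abs_lt.1 ?_)
      simpa [Real.dist_eq] using h)
    simp [this]
  · simp only [Pi.sub_apply]
    by_cases hx : x ∈ Ioo (-1 : ℝ) 1
    · have : χ x = 1 := χ.one_of_mem_closedBall (by
        simpa [Real.dist_eq] using (abs_lt.2 hx).le)
      simp [this]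
    · rw [hf0 x hx, zero_sub, zero_sub, norm_neg, norm_neg, norm_mul]
      refine mul_le_of_le_one_left (norm_nonneg _) ?_
      rw [Complex.norm_real, Real.norm_of_nonneg χ.nonneg]
      exact χ.le_one

theorem eLpNorm_freeEvolution_sub_le {f g : ℝ → ℂ} (hf : MemLp f 2 volume)
    (hf0 : ∀ x ∉ Ioo (-1 : ℝ) 1, f x = 0) (hg : IsTestFun g) {t : ℝ} (ht : 0 < t) :
    eLpNorm (freeEvolution (f - g) t) 2 (volume.restrict (Ioo (0 : ℝ) 1)) ≤
      eLpNorm (f - g) 2 volume := by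
  obtain ⟨C, hC⟩ := exists_eLpNorm_freeEvolution_le ht
  have key : ∀ ε : ℝ, 0 < ε →
      eLpNorm (freeEvolution (f - g) t) 2 (volume.restrict (Ioo (0 : ℝ) 1)) ≤
        C * ENNReal.ofReal ε + (ENNReal.ofReal ε + eLpNorm (f - g) 2 volume) := by
    intro ε hε
    obtain ⟨k, hk, hfk⟩ := exists_isTestFun_eLpNorm_sub_le hf hf0 hε
    have hsum : freeEvolution (f - g) t = freeEvolution (f - k) t + freeEvolution (k - g) t := by
      ext x
      rw [Pi.add_apply, freeEvolution_sub hf hg.memLp ht, freeEvolution_sub hf hk.memLp ht,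
        freeEvolution_sub hk.memLp hg.memLp ht]
      ring
    rw [hsum]
    refine (eLpNorm_add_le
      (continuous_freeEvolution (hf.sub hk.memLp) ht).aestronglyMeasurable
      (continuous_freeEvolution (hk.sub hg).memLp ht).aestronglyMeasurable (by norm_num)).trans ?_
    refine add_le_add ((hC _ (hf.sub hk.memLp)).trans (by gcongr)) ?_
    refine (eLpNorm_mono_measure _ Measure.restrict_le_self).trans
      ((eLpNorm_freeEvolution_le_of_isTestFun (hk.sub hg) ht).trans ?_)
    have : k - g = (k - f) + (f - g) := by simp
    rw [this]
    refine (eLpNorm_add_le (hk.memLp.sub hf).aestronglyMeasurable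
      (hf.sub hg.memLp).aestronglyMeasurable (by norm_num)).trans ?_
    rw [eLpNorm_sub_comm]
    gcongr
  have hlim : Tendsto (fun ε : ℝ => C * ENNReal.ofReal ε +
      (ENNReal.ofReal ε + eLpNorm (f - g) 2 volume)) (𝓝[>] 0)
      (𝓝 (C * ENNReal.ofReal 0 + (ENNReal.ofReal 0 + eLpNorm (f - g) 2 volume))) := by
    have h0 : Tendsto ENNReal.ofReal (𝓝[>] 0) (𝓝 (ENNReal.ofReal 0)) :=
      (ENNReal.continuous_ofReal.tendsto 0).mono_left nhdsWithin_le_nhds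
    exact (ENNReal.Tendsto.const_mul h0 (Or.inr ENNReal.coe_ne_top)).add
      (h0.add tendsto_const_nhds)
  have := ge_of_tendsto hlim (by filter_upwards [self_mem_nhdsWithin] with ε hε using key ε hε)
  simpa using this

/-- Strong continuity at `t = 0` of the free evolution on `L²` functions supported in `(-1, 1)`. -/
theorem tendsto_eLpNorm_freeEvolution_sub {f : ℝ → ℂ} (hf : MemLp f 2 volume)
    (hf0 : ∀ x ∉ Ioo (-1 : ℝ) 1, f x = 0) :
    Tendsto (fun t => eLpNorm (freeEvolution f t - f) 2 (volume.restrict (Ioo (0 : ℝ) 1)))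
      (𝓝[>] 0) (𝓝 0) := by
  rw [ENNReal.tendsto_nhds_zero]
  intro δ hδ
  obtain ⟨ε, hε, hεδ⟩ : ∃ ε : ℝ, 0 < ε ∧ ENNReal.ofReal ε + (ENNReal.ofReal ε + ENNReal.ofReal ε)
      ≤ δ := by
    rcases eq_or_ne δ ⊤ with rfl | h
    · exact ⟨1, one_pos, le_top⟩
    · refine ⟨δ.toReal / 3, div_pos (ENNReal.toReal_pos hδ.ne' h) (by norm_num), ?_⟩
      have : 0 ≤ δ.toReal / 3 := by positivity
      rw [← ENNReal.ofReal_add this this, ← ENNReal.ofReal_add this (add_nonneg this this)]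
      exact (ENNReal.ofReal_le_iff_le_toReal h).2 (by linarith)
  obtain ⟨g, hg, hfg⟩ := exists_isTestFun_eLpNorm_sub_le hf hf0 hε
  filter_upwards [eventually_norm_freeEvolution_sub_le hg hε, self_mem_nhdsWithin] with t h1 ht
  have hsum : freeEvolution f t - f =
      freeEvolution (f - g) t + ((freeEvolution g t - g) + (g - f)) := by
    ext x
    simp only [Pi.add_apply, Pi.sub_apply]
    rw [freeEvolution_sub hf hg.memLp ht]
    ring
  have hgt := continuous_freeEvolution hg.memLp ht
  have hgc := hg.1.continuous
  rw [hsum]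
  refine (eLpNorm_add_le
    (continuous_freeEvolution (hf.sub hg.memLp) ht).aestronglyMeasurable
    ((hgt.sub hgc).aestronglyMeasurable.add
      (hg.memLp.sub hf).aestronglyMeasurable.restrict) (by norm_num)).trans ?_
  refine (add_le_add_right (eLpNorm_add_le (hgt.sub hgc).aestronglyMeasurable
    (hg.memLp.sub hf).aestronglyMeasurable.restrict (by norm_num)) _).trans ?_
  refine le_trans (add_le_add ?_ (add_le_add ?_ ?_)) hεδ
  · exact (eLpNorm_freeEvolution_sub_le hf hf0 hg ht).trans hfg
  · exact eLpNorm_restrict_Ioo_le fun x _ => h1 x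
  · refine (eLpNorm_mono_measure _ Measure.restrict_le_self).trans ?_
    rwa [eLpNorm_sub_comm]

theorem thetaOdd_eq_zero_of_notMem_Ioo {θ₀ : ℝ → ℂ} {x : ℝ} (hx : x ∉ Ioo (-1 : ℝ) 1) :
    thetaOdd θ₀ x = 0 := by
  rw [thetaOdd, if_neg, if_neg]
  · exact fun h => hx ⟨h.1, by linarith [h.2]⟩
  · exact fun h => hx ⟨by linarith [h.1], h.2⟩

theorem tendsto_eLpNorm_trajTheta_zero {θ₀ : ℝ → ℂ} {s M T τ : ℝ} (hτ : τ ∈ Ioo 0 T)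
    (hθ₀ : MemLp θ₀ 2 (volume.restrict (Ioo (0 : ℝ) 1))) :
    Tendsto (fun t => eLpNorm (fun x => trajTheta θ₀ s M T τ t x - trajTheta θ₀ s M T τ 0 x) 2
      (volume.restrict (Ioo (0 : ℝ) 1))) (𝓝[Icc 0 T] 0) (𝓝 0) := by
  have hmono : 𝓝[Icc (0 : ℝ) T] 0 ≤ pure 0 ⊔ 𝓝[>] 0 := by
    rw [← nhdsWithin_singleton, ← nhdsWithin_union, singleton_union, Ioi_insert]
    exact nhdsWithin_mono _ Icc_subset_Ici_self
  refine Tendsto.mono_left (tendsto_sup.2 ⟨?_, ?_⟩) hmono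
  · rw [tendsto_pure_left]
    intro U hU
    simpa using mem_of_mem_nhds hU
  · refine (tendsto_eLpNorm_freeEvolution_sub (memLp_thetaOdd hθ₀)
      fun x hx => thetaOdd_eq_zero_of_notMem_Ioo hx).congr' ?_
    filter_upwards [Ioo_mem_nhdsGT hτ.1] with t ht
    refine eLpNorm_congr_ae ?_
    filter_upwards [ae_restrict_mem measurableSet_Ioo] with x hx
    rw [Pi.sub_apply, freeEvolution, ← thetaMinus_eq_superpose, thetaOdd, if_pos ⟨hx.1, hx.2⟩,
      trajTheta, trajTheta, if_pos rfl, if_neg ht.1.ne', if_pos ht.2.le]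

end Helpers

theorem stmt9 (θ₀ : ℝ → ℂ)
    (hθ₀ : MeasureTheory.MemLp θ₀ 2 (MeasureTheory.volume.restrict (Set.Ioo (0 : ℝ) 1)))
    (T τ s M : ℝ) (hT : 0 < T) (hτ : τ ∈ Set.Ioo 0 T) (hs : s ∈ Set.Ioo (1 : ℝ) 2)
    (hM : 0 < M) :
    -- t ↦ θ(t,⬝) belongs to C([0,T]; L²(0,1))
    (∀ t₀ ∈ Set.Icc (0 : ℝ) T,
      Filter.Tendsto
        (fun t => MeasureTheory.eLpNorm
          (fun x => trajTheta θ₀ s M T τ t x - trajTheta θ₀ s M T τ t₀ x) 2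
          (MeasureTheory.volume.restrict (Set.Ioo (0 : ℝ) 1)))
        (nhdsWithin t₀ (Set.Icc (0 : ℝ) T)) (nhds 0)) ∧
    -- θ is C^∞ on (0,T] × [0,1]
    ContDiffOn ℝ (⊤ : ℕ∞) (fun p : ℝ × ℝ => trajTheta θ₀ s M T τ p.1 p.2)
      (Set.Ioc (0 : ℝ) T ×ˢ Set.Icc (0 : ℝ) 1) ∧
    -- i ∂_t θ + ∂_x² θ = 0 on (0,T] × [0,1]
    (∀ t ∈ Set.Ioc (0 : ℝ) T, ∀ x ∈ Set.Icc (0 : ℝ) 1,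
      Complex.I * deriv (fun t' => trajTheta θ₀ s M T τ t' x) t
        + iteratedDeriv 2 (fun x' => trajTheta θ₀ s M T τ t x') x = 0) ∧
    -- θ(t,0) = 0 on (0,T]
    (∀ t ∈ Set.Ioc (0 : ℝ) T, trajTheta θ₀ s M T τ t 0 = 0) ∧
    -- θ is Gevrey of order (s, s/2) on [ε,T] × [0,1] for every ε ∈ (0,T)
    (∀ ε ∈ Set.Ioo (0 : ℝ) T,
      ∃ C R₁ R₂ : ℝ, 0 < C ∧ 0 < R₁ ∧ 0 < R₂ ∧
        ∀ p₁ p₂ : ℕ, ∀ t ∈ Set.Icc ε T, ∀ x ∈ Set.Icc (0 : ℝ) 1,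
          ‖iteratedDeriv p₁
              (fun t' => iteratedDeriv p₂ (fun x' => trajTheta θ₀ s M T τ t' x') x) t‖
            ≤ C * (p₁.factorial : ℝ) ^ s * (p₂.factorial : ℝ) ^ (s / 2)
              / (R₁ ^ p₁ * R₂ ^ p₂)) ∧
    -- θ(T,⬝) = 0
    (∀ x ∈ Set.Icc (0 : ℝ) 1, trajTheta θ₀ s M T τ T x = 0) := by
  refine ⟨fun t₀ ht₀ => ?_, ?_, fun t ht x _ => schrodinger_trajTheta hs hM hτ hθ₀ ht.1 x,
    fun t ht => trajTheta_zero_right hs.1 hM hτ hθ₀ ht.1,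
    fun ε hε => exists_gevrey_bound_trajTheta hs hM hτ hθ₀ hε.1,
    fun x _ => trajTheta_final hs.1 hM hτ hθ₀ x⟩
  · rcases ht₀.1.eq_or_lt with rfl | h
    · exact tendsto_eLpNorm_trajTheta_zero hτ hθ₀
    · exact (tendsto_eLpNorm_trajTheta_of_pos hs hM hτ hθ₀ h).mono_left nhdsWithin_le_nhds
  · exact (contDiffOn_trajTheta hs hM hτ hθ₀).mono
      (prod_mono (fun t ht => ht.1) (subset_univ _))
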